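/- Let n ≥ 3, 2 ≤ α < n, p = 2(n-1)/(n+α-4), t = 2n/(n+α), and write x = (x′, x_n) ∈ ℝ^n_+ with x′ ∈ ℝ^{n−1}. Then for all nonnegative f ∈ L^p(∂ℝ^n_+) and g ∈ L^t(ℝ^n_+), one has ∫_{ℝ^n_+} ∫_{∂ℝ^n_+} x_n g(x) f(y) (|x′−y|² + x_n²)^{−(n−α+2)/2} dy dx ≤ (C_{e2}(n,α)/2) ‖f‖_{L^p(∂ℝ^n_+)} ‖g‖_{L^t(ℝ^n_+)}, where C_{e2}(n,α) = (nω_n)^{−(n+α−4)/(2(n−1))} · ( ∫_{B^n} ( ∫_{∂B^n} (1 − |ξ − z^o|²) |ξ−ζ|^{−(n−α+2)} dζ )^{2n/(n−α)} dξ )^{(n−α)/(2n)}. -/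

import Mathlib

noncomputable section

open MeasureTheory Metric ENNReal

/-- `ℝ^n` with the Euclidean norm. -/
abbrev Eu (n : ℕ) : Type := EuclideanSpace ℝ (Fin n)

/-- The last coordinate `x_n` of a point `x ∈ ℝ^n`. -/
def lastCoord (n : ℕ) (x : Eu n) : ℝ :=
  if h : 0 < n then x ⟨n - 1, Nat.sub_lt h Nat.one_pos⟩ else 0

/-- The first coordinate `x_1` of a point `x ∈ ℝ^n`. -/
def firstCoord (n : ℕ) (x : Eu n) : ℝ :=
  if h : 0 < n then x ⟨0, h⟩ else 0

/-- The open upper half space `ℝ^n_+ = {x : x_n > 0}`. -/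
def upperHalf (n : ℕ) : Set (Eu n) := {x | 0 < lastCoord n x}

/-- The identification of `ℝ^{n-1}` with the boundary `∂ℝ^n_+ = {x : x_n = 0}`. -/
def emb (n : ℕ) (y : Eu (n - 1)) : Eu n :=
  (EuclideanSpace.equiv (Fin n) ℝ).symm fun i =>
    if h : (i : ℕ) < n - 1 then y ⟨i, h⟩ else 0

/-- The point `z^o = (0,…,0,-1) ∈ ℝ^n`. -/
def zo (n : ℕ) : Eu n :=
  (EuclideanSpace.equiv (Fin n) ℝ).symm fun i => if (i : ℕ) = n - 1 then -1 else 0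

/-- The point `x^o = (0,…,0,-2) ∈ ℝ^n`. -/
def xo (n : ℕ) : Eu n :=
  (EuclideanSpace.equiv (Fin n) ℝ).symm fun i => if (i : ℕ) = n - 1 then -2 else 0

/-- The surface measure on the sphere `∂B^n = {x : |x - z^o| = 1}`. -/
def surf (n : ℕ) : Measure (Eu n) :=
  Measure.map (fun p : sphere (0 : Eu n) 1 => zo n + (p : Eu n))
    (volume : Measure (Eu n)).toSphere

/-- Lebesgue measure restricted to the open unit ball `B^n` centered at `z^o`. -/
def ballM (n : ℕ) : Measure (Eu n) := (volume : Measure (Eu n)).restrict (ball (zo n) 1)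

/-- `ω_n`, the volume of the unit ball in `ℝ^n`. -/
def unitBallVol (n : ℕ) : ℝ := ((volume : Measure (Eu n)) (ball (0 : Eu n) 1)).toReal

/-- `(∫ F^r)^{1/r}` (in `ℝ≥0∞`) of a nonnegative function `F`, for an arbitrary
nonzero real exponent `r`. -/
def eLp {X : Type*} [MeasurableSpace X] (μ : Measure X) (f : X → ℝ) (r : ℝ) : ℝ≥0∞ :=
  (∫⁻ x, ENNReal.ofReal (f x) ^ r ∂μ) ^ (1 / r)

/-- `(∫ F^r)^{1/r}` (in `ℝ≥0∞`) of an `ℝ≥0∞`-valued function `F`. -/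
def eLpE {X : Type*} [MeasurableSpace X] (μ : Measure X) (F : X → ℝ≥0∞) (r : ℝ) : ℝ≥0∞ :=
  (∫⁻ x, F x ^ r ∂μ) ^ (1 / r)

/-- The real `L^r`-norm `(∫ |f|^r)^{1/r}`. -/
def rLp {X : Type*} [MeasurableSpace X] (μ : Measure X) (f : X → ℝ) (r : ℝ) : ℝ :=
  (∫ x, |f x| ^ r ∂μ) ^ (1 / r)

/-- The sharp constant `C_{e1}(n,α)`. -/
def Ce1 (n : ℕ) (α : ℝ) : ℝ :=
  ((n : ℝ) * unitBallVol n) ^ (-(((n : ℝ) + α - 2) / (2 * ((n : ℝ) - 1)))) *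
    (∫ ξ in ball (zo n) 1,
        (∫ ζ, ‖ξ - ζ‖ ^ (α - (n : ℝ)) ∂surf n) ^ (2 * (n : ℝ) / ((n : ℝ) - α))) ^
      (((n : ℝ) - α) / (2 * (n : ℝ)))

/-- The sharp constant `C_{e2}(n,α)`. -/
def Ce2 (n : ℕ) (α : ℝ) : ℝ :=
  ((n : ℝ) * unitBallVol n) ^ (-(((n : ℝ) + α - 4) / (2 * ((n : ℝ) - 1)))) *
    (∫ ξ in ball (zo n) 1,
        (∫ ζ, (1 - ‖ξ - zo n‖ ^ 2) * ‖ξ - ζ‖ ^ (-((n : ℝ) - α + 2)) ∂surf n) ^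
          (2 * (n : ℝ) / ((n : ℝ) - α))) ^ (((n : ℝ) - α) / (2 * (n : ℝ)))

namespace HLS
open EuclideanGeometry

lemma abs_det_inv {k : ℕ} (r : ℝ) (K : Submodule ℝ (Eu k)) :
    |((r ^ 2 • (K.reflection : Eu k →L[ℝ] Eu k)) : Eu k →L[ℝ] Eu k).det| = (r ^ 2) ^ k := by
  have h : ((r ^ 2 • (K.reflection : Eu k →L[ℝ] Eu k)) : Eu k →L[ℝ] Eu k).det
      = (r ^ 2) ^ k * LinearMap.det K.reflection.toLinearMap := by
    rw [ContinuousLinearMap.det]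
    have : ((r ^ 2 • (K.reflection : Eu k →L[ℝ] Eu k) : Eu k →L[ℝ] Eu k) : Eu k →ₗ[ℝ] Eu k)
      = r ^ 2 • K.reflection.toLinearMap := rfl
    rw [this, LinearMap.det_smul]
    simp
  rw [h, abs_mul, K.det_reflection, abs_pow, abs_pow]
  simp

lemma image_inv {k : ℕ} (c : Eu k) {R : ℝ} (hR : 0 < R) :
    inversion c R '' {c}ᶜ = {c}ᶜ := by
  ext x
  constructor
  · rintro ⟨y, hy, rfl⟩
    simpa [inversion_eq_center hR.ne'] using hy
  · intro hx
    refine ⟨inversion c R x, ?_, inversion_inversion c hR.ne' x⟩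
    simpa [inversion_eq_center hR.ne'] using hx

lemma ae_ne {k : ℕ} (hk : 0 < k) (c : Eu k) : ∀ᵐ x : Eu k, x ≠ c := by
  have : Nonempty (Fin k) := ⟨⟨0, hk⟩⟩
  have : Nontrivial (Eu k) := inferInstance
  exact Measure.ae_ne volume c

lemma restrict_compl_singleton {k : ℕ} (hk : 0 < k) (c : Eu k) :
    (volume : Measure (Eu k)).restrict {c}ᶜ = volume := by
  rw [Measure.restrict_eq_self_of_ae_mem]
  filter_upwards [ae_ne hk c] with x hx using hx

lemma inv_lintegral {k : ℕ} (hk : 0 < k) (c : Eu k) {R : ℝ} (hR : 0 < R) (G : Eu k → ℝ≥0∞) :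
    ∫⁻ w, G w = ∫⁻ w, ENNReal.ofReal (((R / ‖w - c‖) ^ 2) ^ k) * G (inversion c R w) := by
  have := lintegral_image_eq_lintegral_abs_det_fderiv_mul (volume : Measure (Eu k))
    (s := {c}ᶜ) (measurableSet_singleton c).compl (f := inversion c R)
    (fun x hx => (hasFDerivAt_inversion (R := R) hx).hasFDerivWithinAt)
    ((inversion_injective c hR.ne').injOn) G
  rw [image_inv c hR, restrict_compl_singleton hk] at this
  simpa [abs_det_inv, dist_eq_norm] using this

lemma inv_integral {k : ℕ} (hk : 0 < k) (c : Eu k) {R : ℝ} (hR : 0 < R) (G : Eu k → ℝ) :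
    ∫ w, G w = ∫ w, ((R / ‖w - c‖) ^ 2) ^ k * G (inversion c R w) := by
  have := integral_image_eq_integral_abs_det_fderiv_smul (volume : Measure (Eu k))
    (s := {c}ᶜ) (measurableSet_singleton c).compl (f := inversion c R)
    (fun x hx => (hasFDerivAt_inversion (R := R) hx).hasFDerivWithinAt)
    ((inversion_injective c hR.ne').injOn) G
  rw [image_inv c hR, restrict_compl_singleton hk] at this
  simpa [abs_det_inv, dist_eq_norm] using this

lemma inv_integrable {k : ℕ} (hk : 0 < k) (c : Eu k) {R : ℝ} (hR : 0 < R) (G : Eu k → ℝ) :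
    Integrable G ↔ Integrable (fun w => ((R / ‖w - c‖) ^ 2) ^ k * G (inversion c R w)) := by
  have := integrableOn_image_iff_integrableOn_abs_det_fderiv_smul (volume : Measure (Eu k))
    (s := {c}ᶜ) (measurableSet_singleton c).compl (f := inversion c R)
    (fun x hx => (hasFDerivAt_inversion (R := R) hx).hasFDerivWithinAt)
    ((inversion_injective c hR.ne').injOn) G
  rw [image_inv c hR, IntegrableOn, IntegrableOn, restrict_compl_singleton hk] at this
  simpa [abs_det_inv, dist_eq_norm] using this

/-- joint measurability of the inversion -/
lemma meas_inv {k : ℕ} {X : Type*} [MeasurableSpace X] {c x : X → Eu k} {R : X → ℝ}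
    (hc : Measurable c) (hR : Measurable R) (hx : Measurable x) :
    Measurable fun w => inversion (c w) (R w) (x w) := by
  unfold inversion
  simp only [vsub_eq_sub, vadd_eq_add]
  exact (((hR.div (hx.dist hc)).pow_const 2).smul (hx.sub hc)).add hc

/-! ### coordinates -/

/-- first `n-1` coordinates -/
def pr (n : ℕ) (x : Eu n) : Eu (n - 1) :=
  (EuclideanSpace.equiv (Fin (n - 1)) ℝ).symm fun i => x ⟨i, by omega⟩

/-- last basis vector -/
def en (n : ℕ) : Eu n :=
  (EuclideanSpace.equiv (Fin n) ℝ).symm fun i => if (i : ℕ) = n - 1 then 1 else 0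

lemma zo_eq (n : ℕ) : zo n = -en n := by
  ext i; simp [zo, en]; split_ifs <;> simp

lemma xo_eq (n : ℕ) : xo n = (-2 : ℝ) • en n := by
  ext i; simp [xo, en]; split_ifs <;> simp

lemma emb_add (n : ℕ) (y z : Eu (n - 1)) : emb n (y + z) = emb n y + emb n z := by
  ext i; simp only [emb, EuclideanSpace.equiv, PiLp.add_apply]; simp; split_ifs <;> simp

lemma emb_smul (n : ℕ) (r : ℝ) (z : Eu (n - 1)) : emb n (r • z) = r • emb n z := by
  ext i; simp [emb]

lemma pr_add (n : ℕ) (y z : Eu n) : pr n (y + z) = pr n y + pr n z := by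
  ext i; simp [pr]

lemma pr_smul (n : ℕ) (r : ℝ) (z : Eu n) : pr n (r • z) = r • pr n z := by
  ext i; simp [pr]

lemma last_add (n : ℕ) (y z : Eu n) : lastCoord n (y + z) = lastCoord n y + lastCoord n z := by
  simp only [lastCoord]; split_ifs <;> simp

lemma last_smul (n : ℕ) (r : ℝ) (z : Eu n) : lastCoord n (r • z) = r * lastCoord n z := by
  simp only [lastCoord]; split_ifs <;> simp

lemma last_emb (n : ℕ) (y : Eu (n - 1)) : lastCoord n (emb n y) = 0 := by
  simp only [lastCoord]; split_ifs <;> simp [emb]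

lemma last_en {n : ℕ} (hn : 0 < n) : lastCoord n (en n) = 1 := by
  simp [lastCoord, en, hn]

lemma pr_emb (n : ℕ) (y : Eu (n - 1)) : pr n (emb n y) = y := by
  ext i; simp [pr, emb]

lemma pr_en (n : ℕ) : pr n (en n) = 0 := by
  ext i
  have := i.2
  simp [pr, en]; omega

lemma norm_sq_split {n : ℕ} (hn : 0 < n) (x : Eu n) :
    ‖x‖ ^ 2 = ‖pr n x‖ ^ 2 + lastCoord n x ^ 2 := by
  obtain ⟨k, rfl⟩ : ∃ k, n = k + 1 := ⟨n - 1, by omega⟩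
  rw [EuclideanSpace.norm_sq_eq, EuclideanSpace.norm_sq_eq, Fin.sum_univ_castSucc]
  simp [lastCoord, pr]
  congr 1

lemma emb_sub (n : ℕ) (y z : Eu (n - 1)) : emb n (y - z) = emb n y - emb n z := by
  have h := emb_smul n (-1) z
  rw [sub_eq_add_neg, emb_add, ← neg_one_smul ℝ z, h]; simp [sub_eq_add_neg]

lemma pr_sub (n : ℕ) (y z : Eu n) : pr n (y - z) = pr n y - pr n z := by
  ext i; simp [pr]

lemma last_sub (n : ℕ) (y z : Eu n) : lastCoord n (y - z) = lastCoord n y - lastCoord n z := by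
  simp only [lastCoord]; split_ifs <;> simp

lemma decomp {n : ℕ} (hn : 0 < n) (x : Eu n) :
    x = emb n (pr n x) + lastCoord n x • en n := by
  rw [← sub_eq_zero, ← norm_eq_zero, ← sq_eq_zero_iff, norm_sq_split hn]
  simp [pr_sub, last_sub, pr_add, last_add, pr_emb, last_emb, pr_smul, last_smul, pr_en,
    last_en hn]

lemma norm_emb {n : ℕ} (hn : 0 < n) (y : Eu (n - 1)) : ‖emb n y‖ = ‖y‖ := by
  have := norm_sq_split hn (emb n y)
  rw [pr_emb, last_emb] at this
  simpa using this

lemma norm_sub_emb_sq {n : ℕ} (hn : 0 < n) (x : Eu n) (y : Eu (n - 1)) :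
    ‖x - emb n y‖ ^ 2 = ‖pr n x - y‖ ^ 2 + lastCoord n x ^ 2 := by
  rw [norm_sq_split hn, pr_sub, last_sub, pr_emb, last_emb, sub_zero]

lemma cont_pr (n : ℕ) : Continuous (pr n) := by
  unfold pr; fun_prop

lemma cont_emb (n : ℕ) : Continuous (emb n) := by
  unfold emb
  refine (EuclideanSpace.equiv (Fin n) ℝ).symm.continuous.comp (continuous_pi fun i => ?_)
  split_ifs <;> fun_prop

lemma cont_last (n : ℕ) : Continuous (lastCoord n) := by
  unfold lastCoord; split_ifs <;> fun_prop

lemma meas_upper (n : ℕ) : MeasurableSet (upperHalf n) :=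
  (isOpen_lt continuous_const (cont_last n)).measurableSet

lemma emb_inversion {n : ℕ} (hn : 0 < n) (a : Eu (n - 1)) (R : ℝ) (y : Eu (n - 1)) :
    inversion (emb n a) R (emb n y) = emb n (inversion a R y) := by
  simp [inversion, dist_eq_norm, ← emb_sub, norm_emb hn, emb_add, emb_smul]

lemma last_inversion {n : ℕ} (a : Eu (n - 1)) (R : ℝ) (x : Eu n) :
    lastCoord n (inversion (emb n a) R x) = (R / ‖x - emb n a‖) ^ 2 * lastCoord n x := by
  simp [inversion, dist_eq_norm, last_add, last_smul, last_sub, last_emb]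

lemma norm_inv_inv {k : ℕ} {a x y : Eu k} (hx : x ≠ a) (hy : y ≠ a) (R : ℝ) :
    ‖inversion a R x - inversion a R y‖ = (R / ‖x - a‖) * (R / ‖y - a‖) * ‖x - y‖ := by
  rw [← dist_eq_norm, dist_inversion_inversion hx hy, dist_eq_norm, dist_eq_norm, dist_eq_norm]
  ring

lemma norm_inv_center {k : ℕ} (a x : Eu k) (R : ℝ) :
    ‖inversion a R x - a‖ = R ^ 2 / ‖x - a‖ := by
  rw [← dist_eq_norm, dist_inversion_center, dist_eq_norm]

/-- the key two-point identity -/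
lemma key_identity {k : ℕ} {a x y : Eu k} (hy : y ≠ a) {R : ℝ} (hR : 0 < R) :
    (‖x - inversion a R y‖ * (‖y - a‖ / R)) ^ 2 =
      ‖x - y‖ ^ 2 + (R ^ 2 - ‖x - a‖ ^ 2) * (R ^ 2 - ‖y - a‖ ^ 2) / R ^ 2 := by
  have h0 : ‖y - a‖ ≠ 0 := norm_ne_zero_iff.2 (sub_ne_zero.2 hy)
  have e1 : x - inversion a R y = (x - a) - (R / ‖y - a‖) ^ 2 • (y - a) := by
    simp [inversion, dist_eq_norm]; abel
  have e2 : x - y = (x - a) - (y - a) := by abel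
  rw [mul_pow, e1, e2]
  generalize x - a = X
  rw [norm_sub_sq_real, norm_sub_sq_real, norm_smul, real_inner_smul_right]
  simp only [norm_pow, norm_div, Real.norm_eq_abs, abs_norm, abs_of_pos hR]
  field_simp
  ring

end HLS

namespace HLS
open EuclideanGeometry

/-- standing hypotheses -/
structure Par (n : ℕ) (α : ℝ) : Prop where
  hn : 3 ≤ n
  h2 : 2 ≤ α
  hlt : α < (n : ℝ)

def mm (n : ℕ) (α : ℝ) : ℝ := (n : ℝ) - α + 2
def kap (n : ℕ) (α : ℝ) : ℝ := ((n : ℝ) + α - 4) / 2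
def pp (n : ℕ) (α : ℝ) : ℝ := 2 * ((n : ℝ) - 1) / ((n : ℝ) + α - 4)
def qq (n : ℕ) (α : ℝ) : ℝ := 2 * (n : ℝ) / ((n : ℝ) - α)

/-- the kernel -/
def KK (n : ℕ) (α : ℝ) (x : Eu n) (y : Eu (n - 1)) : ℝ :=
  lastCoord n x * ‖x - emb n y‖ ^ (-mm n α)

/-- the extremal function -/
def hh (n : ℕ) (α : ℝ) (y : Eu (n - 1)) : ℝ := (4 / (4 + ‖y‖ ^ 2)) ^ kap n α

/-- the extension operator -/
def Op (n : ℕ) (α : ℝ) (f : Eu (n - 1) → ℝ) (x : Eu n) : ℝ := ∫ y, KK n α x y * f y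

/-- conformal reflection of a function -/
def tw (n : ℕ) (α : ℝ) (a : Eu (n - 1)) (R : ℝ) (f : Eu (n - 1) → ℝ) (y : Eu (n - 1)) : ℝ :=
  (R / ‖y - a‖) ^ (2 * kap n α) * f (inversion a R y)

/-- reflected kernel -/
def Kt (n : ℕ) (α : ℝ) (a : Eu (n - 1)) (R : ℝ) (x : Eu n) (y : Eu (n - 1)) : ℝ :=
  lastCoord n x * (‖x - emb n (inversion a R y)‖ * (‖y - a‖ / R)) ^ (-mm n α)

section
variable {n : ℕ} {α : ℝ}

lemma Par.npos (H : Par n α) : 0 < n := by have := H.hn; omega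
lemma Par.n1pos (H : Par n α) : 0 < n - 1 := by have := H.hn; omega
lemma Par.hnR (H : Par n α) : (3 : ℝ) ≤ n := by exact_mod_cast H.hn
lemma Par.cast (H : Par n α) : ((n - 1 : ℕ) : ℝ) = (n : ℝ) - 1 := by
  have := H.hn; push_cast [Nat.cast_sub (by omega : 1 ≤ n)]; ring
lemma Par.kap_pos (H : Par n α) : 0 < kap n α := by
  have := H.hnR; have := H.h2; unfold kap; linarith
lemma Par.mm_pos (H : Par n α) : 0 < mm n α := by
  have := H.hlt; unfold mm; linarith
lemma Par.sum (H : Par n α) : mm n α + 2 * kap n α = 2 * ((n : ℝ) - 1) := by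
  unfold mm kap; ring
lemma Par.kp (H : Par n α) : kap n α * pp n α = (n : ℝ) - 1 := by
  have := H.hnR; have := H.h2
  unfold pp kap; field_simp
  rw [mul_div_cancel_left₀ _ (by linarith)]
lemma Par.p_gt (H : Par n α) : 1 < pp n α := by
  have := H.hnR; have := H.h2; have := H.hlt
  unfold pp; rw [lt_div_iff₀ (by linarith)]; linarith
lemma Par.q_gt (H : Par n α) : 1 < qq n α := by
  have := H.hnR; have := H.h2; have := H.hlt
  unfold qq; rw [lt_div_iff₀ (by linarith)]; linarith
lemma Par.qm (H : Par n α) : (mm n α - 2) * qq n α = 2 * n := by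
  have := H.hlt
  unfold qq mm
  have : (n : ℝ) - α ≠ 0 := by linarith
  rw [show (n : ℝ) - α + 2 - 2 = (n : ℝ) - α by ring]
  field_simp

lemma pow_rpow (r : ℝ) (hr : 0 ≤ r) (k : ℕ) : (r ^ 2) ^ k = r ^ (2 * (k : ℝ)) := by
  rw [Real.rpow_mul hr, Real.rpow_natCast]; norm_num

lemma upper_pos {x : Eu n} (hx : x ∈ upperHalf n) : 0 < lastCoord n x := hx

lemma norm_pos_of_upper {x : Eu n} (hx : x ∈ upperHalf n) (y : Eu (n - 1)) :
    0 < ‖x - emb n y‖ := by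
  rw [norm_pos_iff, sub_ne_zero]
  rintro rfl
  have := upper_pos hx
  simp [last_emb] at this

lemma KK_nonneg {x : Eu n} (hx : x ∈ upperHalf n) (y : Eu (n - 1)) : 0 ≤ KK n α x y :=
  mul_nonneg hx.le (by positivity)

lemma inv_upper (H : Par n α) {x : Eu n} (hx : x ∈ upperHalf n) (a : Eu (n - 1)) {R : ℝ}
    (hR : 0 < R) : inversion (emb n a) R x ∈ upperHalf n := by
  have h1 := norm_pos_of_upper hx a
  have := upper_pos hx
  show 0 < lastCoord n _
  rw [last_inversion]; positivity

lemma ne_of_upper {x : Eu n} (hx : x ∈ upperHalf n) (a : Eu (n - 1)) : x ≠ emb n a :=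
  sub_ne_zero.1 (norm_pos_iff.1 (norm_pos_of_upper hx a))

lemma emb_ne {y a : Eu (n - 1)} (hy : y ≠ a) : emb n y ≠ emb n a := fun h => hy (by
  rw [← pr_emb n y, h, pr_emb])

lemma norm_emb_sub (H : Par n α) (y a : Eu (n - 1)) : ‖emb n y - emb n a‖ = ‖y - a‖ := by
  rw [← emb_sub, norm_emb H.npos]

lemma KK_inv (H : Par n α) {x : Eu n} (hx : x ∈ upperHalf n) {y a : Eu (n - 1)} {R : ℝ}
    (hR : 0 < R) (hy : y ≠ a) :
    KK n α (inversion (emb n a) R x) (inversion a R y) =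
      KK n α x y * (R / ‖x - emb n a‖) ^ (2 - mm n α) * (R / ‖y - a‖) ^ (-mm n α) := by
  have h1 := norm_pos_of_upper hx a
  have h2 := norm_pos_of_upper hx y
  have h3 : 0 < ‖y - a‖ := norm_pos_iff.2 (sub_ne_zero.2 hy)
  unfold KK
  rw [← emb_inversion H.npos, norm_inv_inv (ne_of_upper hx a) (emb_ne hy), last_inversion,
    norm_emb_sub H, Real.mul_rpow (by positivity) (by positivity),
    Real.mul_rpow (by positivity) (by positivity), sub_eq_add_neg 2,
    Real.rpow_add (by positivity)]
  norm_num
  ring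

lemma meas_KK (x : Eu n) : Measurable (KK n α x) := by
  unfold KK
  have := (cont_emb n).measurable
  fun_prop

lemma meas_KK2 : Measurable (fun z : Eu n × Eu (n - 1) => KK n α z.1 z.2) := by
  unfold KK
  have := (cont_emb n).measurable
  have := (cont_last n).measurable
  fun_prop

lemma meas_tw (a : Eu (n - 1)) (R : ℝ) {f : Eu (n - 1) → ℝ} (hf : Measurable f) :
    Measurable (tw n α a R f) := by
  unfold tw
  have : Measurable (fun y : Eu (n - 1) => inversion a R y) :=
    meas_inv measurable_const measurable_const measurable_id
  fun_prop

lemma jac_eq (H : Par n α) {y a : Eu (n - 1)} {R : ℝ} (hR : 0 < R) (hy : y ≠ a) :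
    ((R / ‖y - a‖) ^ 2) ^ (n - 1) = (R / ‖y - a‖) ^ mm n α * (R / ‖y - a‖) ^ (2 * kap n α) := by
  have h3 : 0 < ‖y - a‖ := norm_pos_iff.2 (sub_ne_zero.2 hy)
  rw [pow_rpow _ (by positivity), H.cast, ← H.sum, Real.rpow_add (by positivity)]

lemma KK_tw_pt (H : Par n α) {x : Eu n} (hx : x ∈ upperHalf n) {y a : Eu (n - 1)} {R : ℝ}
    (hR : 0 < R) (hy : y ≠ a) (f : Eu (n - 1) → ℝ) :
    KK n α x y * tw n α a R f y = (R / ‖x - emb n a‖) ^ (mm n α - 2) *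
      (((R / ‖y - a‖) ^ 2) ^ (n - 1) *
        (KK n α (inversion (emb n a) R x) (inversion a R y) * f (inversion a R y))) := by
  have h1 := norm_pos_of_upper hx a
  have h3 : 0 < ‖y - a‖ := norm_pos_iff.2 (sub_ne_zero.2 hy)
  rw [KK_inv H hx hR hy, jac_eq H hR hy, tw]
  have e1 : (R / ‖x - emb n a‖) ^ (mm n α - 2) * (R / ‖x - emb n a‖) ^ (2 - mm n α) = 1 := by
    rw [← Real.rpow_add (by positivity)]; simp
  have e2 : (R / ‖y - a‖) ^ (mm n α) * (R / ‖y - a‖) ^ (-mm n α) = 1 := by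
    rw [← Real.rpow_add (by positivity)]; simp
  linear_combination (-KK n α x y * (R / ‖y - a‖) ^ (2 * kap n α) * f (inversion a R y)) * 
    (e1 * ((R / ‖y - a‖) ^ (mm n α) * (R / ‖y - a‖) ^ (-mm n α)) + e2)

lemma Op_tw (H : Par n α) {x : Eu n} (hx : x ∈ upperHalf n) (a : Eu (n - 1)) {R : ℝ}
    (hR : 0 < R) (f : Eu (n - 1) → ℝ) :
    Op n α (tw n α a R f) x =
      (R / ‖x - emb n a‖) ^ (mm n α - 2) * Op n α f (inversion (emb n a) R x) := by
  unfold Op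
  rw [inv_integral H.n1pos a hR (fun y => KK n α (inversion (emb n a) R x) y * f y),
    ← integral_const_mul]
  apply integral_congr_ae
  filter_upwards [ae_ne H.n1pos a] with y hy using KK_tw_pt H hx hR hy f

lemma int_tw (H : Par n α) {x : Eu n} (hx : x ∈ upperHalf n) (a : Eu (n - 1)) {R : ℝ}
    (hR : 0 < R) {f : Eu (n - 1) → ℝ}
    (hf : Integrable (fun y => KK n α (inversion (emb n a) R x) y * f y)) :
    Integrable (fun y => KK n α x y * tw n α a R f y) := by
  rw [inv_integrable H.n1pos a hR] at hf
  refine (hf.const_mul ((R / ‖x - emb n a‖) ^ (mm n α - 2))).congr ?_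
  filter_upwards [ae_ne H.n1pos a] with y hy using (KK_tw_pt H hx hR hy f).symm

lemma Kt_tw_pt (H : Par n α) (x : Eu n) {y a : Eu (n - 1)} {R : ℝ}
    (hR : 0 < R) (hy : y ≠ a) (f : Eu (n - 1) → ℝ) :
    Kt n α a R x y * tw n α a R f y =
      (((R / ‖y - a‖) ^ 2) ^ (n - 1) *
        (KK n α x (inversion a R y) * f (inversion a R y))) := by
  have h3 : 0 < ‖y - a‖ := norm_pos_iff.2 (sub_ne_zero.2 hy)
  rw [jac_eq H hR hy, tw, Kt, KK, Real.mul_rpow (by positivity) (by positivity),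
    Real.rpow_neg (x := ‖y - a‖ / R) (by positivity), ← Real.inv_rpow (by positivity), inv_div]
  ring

lemma Op_eq_Kt (H : Par n α) (x : Eu n) (a : Eu (n - 1)) {R : ℝ}
    (hR : 0 < R) (f : Eu (n - 1) → ℝ) :
    Op n α f x = ∫ y, Kt n α a R x y * tw n α a R f y := by
  unfold Op
  rw [inv_integral H.n1pos a hR (fun y => KK n α x y * f y)]
  apply integral_congr_ae
  filter_upwards [ae_ne H.n1pos a] with y hy using (Kt_tw_pt H x hR hy f).symm

lemma int_Kt_tw (H : Par n α) (x : Eu n) (a : Eu (n - 1)) {R : ℝ}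
    (hR : 0 < R) {f : Eu (n - 1) → ℝ} (hf : Integrable (fun y => KK n α x y * f y)) :
    Integrable (fun y => Kt n α a R x y * tw n α a R f y) := by
  rw [inv_integrable H.n1pos a hR] at hf
  refine hf.congr ?_
  filter_upwards [ae_ne H.n1pos a] with y hy using (Kt_tw_pt H x hR hy f).symm

lemma tw_tw {y a : Eu (n - 1)} {R : ℝ} (hR : 0 < R) (hy : y ≠ a) (f : Eu (n - 1) → ℝ) :
    tw n α a R (tw n α a R f) y = f y := by
  have h3 : 0 < ‖y - a‖ := norm_pos_iff.2 (sub_ne_zero.2 hy)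
  unfold tw
  rw [inversion_inversion _ hR.ne', norm_inv_center, ← mul_assoc,
    ← Real.mul_rpow (by positivity) (by positivity)]
  have : R / ‖y - a‖ * (R / (R ^ 2 / ‖y - a‖)) = 1 := by field_simp
  rw [this]; simp

lemma int_Kt (H : Par n α) {x : Eu n} (hx : x ∈ upperHalf n) (a : Eu (n - 1)) {R : ℝ}
    (hR : 0 < R) {f : Eu (n - 1) → ℝ}
    (hf : Integrable (fun y => KK n α (inversion (emb n a) R x) y * f y)) :
    Integrable (fun y => Kt n α a R x y * f y) := by
  refine (int_Kt_tw H x a hR (int_tw H hx a hR hf)).congr ?_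
  filter_upwards [ae_ne H.n1pos a] with y hy
  rw [tw_tw hR hy]

lemma Kt_nonneg {x : Eu n} (hx : x ∈ upperHalf n) (a y : Eu (n - 1)) {R : ℝ} (hR : 0 < R) :
    0 ≤ Kt n α a R x y :=
  mul_nonneg hx.le (by positivity)

lemma key_V (H : Par n α) (x : Eu n) {y a : Eu (n - 1)} {R : ℝ} (hR : 0 < R) (hy : y ≠ a) :
    (‖x - emb n (inversion a R y)‖ * (‖y - a‖ / R)) ^ 2 =
      ‖x - emb n y‖ ^ 2 + (R ^ 2 - ‖x - emb n a‖ ^ 2) * (R ^ 2 - ‖y - a‖ ^ 2) / R ^ 2 := by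
  have := key_identity (x := x) (emb_ne hy) hR
  rwa [emb_inversion H.npos, norm_emb_sub H] at this

lemma Kt_le (H : Par n α) {x : Eu n} (hx : x ∈ upperHalf n) {y a : Eu (n - 1)} {R : ℝ}
    (hR : 0 < R) (hy : y ≠ a) (hs : 0 ≤ (R ^ 2 - ‖x - emb n a‖ ^ 2) * (R ^ 2 - ‖y - a‖ ^ 2)) :
    Kt n α a R x y ≤ KK n α x y := by
  have h2 := norm_pos_of_upper hx y
  refine mul_le_mul_of_nonneg_left ?_ hx.le
  refine Real.rpow_le_rpow_of_nonpos h2 ?_ (by linarith [H.mm_pos])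
  refine le_of_sq_le_sq ?_ (by positivity)
  rw [key_V H x hR hy]
  have : 0 ≤ (R ^ 2 - ‖x - emb n a‖ ^ 2) * (R ^ 2 - ‖y - a‖ ^ 2) / R ^ 2 := by positivity
  linarith

lemma le_Kt (H : Par n α) {x : Eu n} (hx : x ∈ upperHalf n) {y a : Eu (n - 1)} {R : ℝ}
    (hR : 0 < R) (hy : y ≠ a) (hs : (R ^ 2 - ‖x - emb n a‖ ^ 2) * (R ^ 2 - ‖y - a‖ ^ 2) ≤ 0) :
    KK n α x y ≤ Kt n α a R x y := by
  have h2 := norm_pos_of_upper hx (inversion a R y)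
  have h3 : 0 < ‖y - a‖ := norm_pos_iff.2 (sub_ne_zero.2 hy)
  refine mul_le_mul_of_nonneg_left ?_ hx.le
  refine Real.rpow_le_rpow_of_nonpos (by positivity) ?_ (by linarith [H.mm_pos])
  refine le_of_sq_le_sq ?_ (by positivity)
  rw [key_V H x hR hy]
  have : (R ^ 2 - ‖x - emb n a‖ ^ 2) * (R ^ 2 - ‖y - a‖ ^ 2) / R ^ 2 ≤ 0 :=
    div_nonpos_of_nonpos_of_nonneg hs (by positivity)
  linarith

lemma hh_pos (y : Eu (n - 1)) : 0 < hh n α y := by unfold hh; positivity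

lemma meas_hh : Measurable (hh n α) := by unfold hh; fun_prop

/-- comparison of `h` and its reflection -/
lemma tw_hh (H : Par n α) {y a : Eu (n - 1)} {R : ℝ} (hR : 0 < R) (hy : y ≠ a) :
    0 < 4 + ‖y‖ ^ 2 + (R ^ 2 - (4 + ‖a‖ ^ 2)) * (R ^ 2 - ‖y - a‖ ^ 2) / R ^ 2 ∧
    tw n α a R (hh n α) y =
      (4 / (4 + ‖y‖ ^ 2 + (R ^ 2 - (4 + ‖a‖ ^ 2)) * (R ^ 2 - ‖y - a‖ ^ 2) / R ^ 2)) ^ kap n α := by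
  have h3 : 0 < ‖y - a‖ := norm_pos_iff.2 (sub_ne_zero.2 hy)
  have key := key_V H ((2 : ℝ) • en n) hR hy
  have e : ∀ z : Eu (n - 1), ‖(2 : ℝ) • en n - emb n z‖ ^ 2 = 4 + ‖z‖ ^ 2 := by
    intro z
    rw [norm_sub_emb_sq H.npos, pr_smul, pr_en, last_smul, last_en H.npos]
    simp; ring
  rw [mul_pow, e, e, e] at key
  rw [← key]
  refine ⟨by positivity, ?_⟩
  unfold tw hh
  rw [Real.rpow_mul (by positivity), ← Real.mul_rpow (by positivity) (by positivity)]
  congr 1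
  norm_num
  field_simp

end
end HLS

namespace HLS
open EuclideanGeometry

section
variable {n : ℕ} {α : ℝ}

/-- admissible functions -/
structure Adm (n : ℕ) (α M : ℝ) (f : Eu (n - 1) → ℝ) : Prop where
  meas : Measurable f
  nonneg : ∀ y, 0 ≤ f y
  le : ∀ y, f y ≤ M * hh n α y

lemma hh_p (H : Par n α) (y : Eu (n - 1)) :
    hh n α y ^ pp n α = (4 / (4 + ‖y‖ ^ 2)) ^ ((n : ℝ) - 1) := by
  unfold hh
  rw [← Real.rpow_mul (by positivity), H.kp]

lemma hh_p_int (H : Par n α) : Integrable (fun y => hh n α y ^ pp n α) := by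
  have h := integrable_rpow_neg_one_add_norm_sq (E := Eu (n - 1)) (μ := volume)
    (r := 2 * ((n : ℝ) - 1)) (by
      have := H.cast; have := H.hnR
      simp only [finrank_euclideanSpace, Fintype.card_fin]; linarith)
  refine (h.const_mul ((4 : ℝ) ^ ((n : ℝ) - 1))).mono' ?_ ?_
  · exact (meas_hh.pow_const _).aestronglyMeasurable
  · refine Filter.Eventually.of_forall fun y => ?_
    have := H.hnR
    rw [hh_p H, Real.norm_of_nonneg (by positivity),
      show -(2 * ((n : ℝ) - 1)) / 2 = -((n : ℝ) - 1) by ring, Real.rpow_neg (by positivity),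
      Real.div_rpow (by positivity) (by positivity), div_eq_mul_inv]
    gcongr
    · linarith
    · linarith

lemma hh_p1 (H : Par n α) (y : Eu (n - 1)) :
    hh n α y ^ (pp n α - 1) = (4 / (4 + ‖y‖ ^ 2)) ^ (mm n α / 2) := by
  unfold hh
  rw [← Real.rpow_mul (by positivity)]
  congr 1
  have := H.kp; have := H.sum
  linarith

lemma norm_2en (H : Par n α) (z : Eu (n - 1)) : ‖(2 : ℝ) • en n - emb n z‖ ^ 2 = 4 + ‖z‖ ^ 2 := by
  rw [norm_sub_emb_sq H.npos, pr_smul, pr_en, last_smul, last_en H.npos]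
  simp; ring

lemma last_le (H : Par n α) {x : Eu n} (y : Eu (n - 1)) :
    lastCoord n x ≤ ‖x - emb n y‖ := by
  refine le_of_sq_le_sq ?_ (norm_nonneg _)
  rw [norm_sub_emb_sq H.npos]
  have := sq_nonneg (‖pr n x - y‖)
  linarith

lemma KK_bound (H : Par n α) {x : Eu n} (hx : x ∈ upperHalf n) :
    ∃ C, 0 ≤ C ∧ ∀ y, KK n α x y ≤ C * hh n α y ^ (pp n α - 1) := by
  have hx0 := upper_pos hx
  set B := ‖(2 : ℝ) • en n - x‖ / lastCoord n x + 1 with hB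
  have hBp : 0 < B := by positivity
  refine ⟨lastCoord n x * (B / 2) ^ mm n α, by positivity, fun y => ?_⟩
  have h2 := norm_pos_of_upper hx y
  rw [hh_p1 H, KK, mul_assoc]
  refine mul_le_mul_of_nonneg_left ?_ hx0.le
  have hm := H.mm_pos
  set w := ‖(2 : ℝ) • en n - emb n y‖ with hw
  have hw2 : w ^ 2 = 4 + ‖y‖ ^ 2 := norm_2en H y
  have hwp : 0 < w := by
    have : 0 < w ^ 2 := by rw [hw2]; positivity
    exact lt_of_le_of_ne (norm_nonneg _) (fun h => by rw [← h] at this; simp at this)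
  have e : (4 / (4 + ‖y‖ ^ 2)) ^ (mm n α / 2) = (2 / w) ^ mm n α := by
    rw [← hw2, show (4 : ℝ) / w ^ 2 = (2 / w) ^ (2 : ℝ) by norm_num; ring,
      ← Real.rpow_mul (by positivity)]
    congr 1; ring
  rw [e, ← Real.mul_rpow (by positivity) (by positivity), Real.rpow_neg (by positivity),
    ← Real.inv_rpow (by positivity)]
  refine Real.rpow_le_rpow (by positivity) ?_ hm.le
  have hwle : w ≤ B * ‖x - emb n y‖ := by
    have t : w ≤ ‖(2 : ℝ) • en n - x‖ + ‖x - emb n y‖ := by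
      have := norm_add_le ((2 : ℝ) • en n - x) (x - emb n y)
      simpa [hw] using this
    have := last_le H (x := x) y
    rw [hB, add_mul, one_mul]
    have : ‖(2 : ℝ) • en n - x‖ ≤ ‖(2 : ℝ) • en n - x‖ / lastCoord n x * ‖x - emb n y‖ := by
      rw [div_mul_eq_mul_div, le_div_iff₀ hx0]
      gcongr
    linarith
  rw [show B / 2 * (2 / w) = B / w by field_simp, inv_eq_one_div, div_le_div_iff₀ h2 hwp]
  linarith

lemma hp_split (y : Eu (n - 1)) (H : Par n α) :
    hh n α y ^ (pp n α - 1) * hh n α y = hh n α y ^ pp n α := by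
  rw [← Real.rpow_add_one (hh_pos y).ne']; ring_nf

/-- integrability of kernel times functions bounded by `M h` -/
lemma int_K (H : Par n α) {x : Eu n} (hx : x ∈ upperHalf n) {M : ℝ} {f : Eu (n - 1) → ℝ}
    (hf : Measurable f) (hb : ∀ y, |f y| ≤ M * hh n α y) :
    Integrable (fun y => KK n α x y * f y) := by
  obtain ⟨C, hC, hK⟩ := KK_bound H hx
  refine ((hh_p_int H).const_mul (C * M)).mono' ((meas_KK x).mul hf).aestronglyMeasurable ?_
  refine Filter.Eventually.of_forall fun y => ?_
  rw [norm_mul, Real.norm_of_nonneg (KK_nonneg hx y), Real.norm_eq_abs]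
  calc KK n α x y * |f y| ≤ (C * hh n α y ^ (pp n α - 1)) * (M * hh n α y) :=
        mul_le_mul (hK y) (hb y) (abs_nonneg _) (by have := hh_pos (n := n) (α := α) y; positivity)
    _ = C * M * hh n α y ^ pp n α := by rw [← hp_split y H]; ring

lemma Adm.abs_le {M : ℝ} {f : Eu (n - 1) → ℝ} (hf : Adm n α M f) (y) : |f y| ≤ M * hh n α y := by
  rw [abs_of_nonneg (hf.nonneg y)]; exact hf.le y

lemma Adm.int (H : Par n α) {M : ℝ} {f : Eu (n - 1) → ℝ} (hf : Adm n α M f) {x : Eu n}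
    (hx : x ∈ upperHalf n) : Integrable (fun y => KK n α x y * f y) :=
  int_K H hx hf.meas hf.abs_le

lemma hh_adm : Adm n α 1 (hh n α) := ⟨meas_hh, fun y => (hh_pos y).le, fun y => by simp⟩

/-! ### integrability of the extension -/

/-- the bracket `w` -/
lemma w_eq (H : Par n α) (y : Eu (n - 1)) : ‖emb n y - xo n‖ ^ 2 = 4 + ‖y‖ ^ 2 := by
  rw [norm_sq_split H.npos, xo_eq, pr_sub, last_sub, pr_emb, last_emb, pr_smul, last_smul, pr_en,
    last_en H.npos]
  simp; ring

lemma w_ge (H : Par n α) (y : Eu (n - 1)) : 2 ≤ ‖emb n y - xo n‖ := by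
  refine le_of_sq_le_sq ?_ (norm_nonneg _)
  rw [w_eq H]; nlinarith [sq_nonneg ‖y‖]

lemma W_eq (H : Par n α) (x : Eu n) :
    ‖x - xo n‖ ^ 2 = ‖x‖ ^ 2 + 4 * lastCoord n x + 4 := by
  rw [norm_sq_split H.npos, norm_sq_split H.npos x, xo_eq, pr_sub, last_sub, pr_smul, last_smul,
    pr_en, last_en H.npos]
  simp; ring

lemma W_ge (H : Par n α) {x : Eu n} (hx : x ∈ upperHalf n) : 2 ≤ ‖x - xo n‖ := by
  refine le_of_sq_le_sq ?_ (norm_nonneg _)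
  rw [W_eq H]; nlinarith [sq_nonneg ‖x‖, upper_pos hx]

lemma W_ge' (H : Par n α) {x : Eu n} (hx : x ∈ upperHalf n) : ‖x‖ ≤ ‖x - xo n‖ := by
  refine le_of_sq_le_sq ?_ (norm_nonneg _)
  rw [W_eq H]; nlinarith [upper_pos hx]

lemma last_le_W (H : Par n α) {x : Eu n} (hx : x ∈ upperHalf n) : lastCoord n x ≤ ‖x - xo n‖ := by
  refine le_trans ?_ (W_ge' H hx)
  refine le_of_sq_le_sq ?_ (norm_nonneg _)
  rw [norm_sq_split H.npos]; nlinarith [sq_nonneg ‖pr n x‖]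

lemma hh_w (H : Par n α) (y : Eu (n - 1)) :
    hh n α y = 4 ^ kap n α * ‖emb n y - xo n‖ ^ (-((n : ℝ) + α - 4)) := by
  have hw := w_ge H y
  unfold hh
  rw [← w_eq H, Real.div_rpow (by positivity) (by positivity), Real.rpow_neg (by positivity),
    div_eq_mul_inv, ← Real.rpow_natCast, ← Real.rpow_mul (by positivity)]
  congr 3
  unfold kap; push_cast; ring

/-- Poisson kernel -/
def Poi (n : ℕ) (x : Eu n) (y : Eu (n - 1)) : ℝ := lastCoord n x * ‖x - emb n y‖ ^ (-(n : ℝ))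

lemma Poi_eq (H : Par n α) {x : Eu n} (hx : x ∈ upperHalf n) (y : Eu (n - 1)) :
    Poi n x y = (lastCoord n x ^ (n - 1))⁻¹ *
      (1 + ‖(lastCoord n x)⁻¹ • (pr n x - y)‖ ^ 2) ^ (-(n : ℝ) / 2) := by
  have hx0 := upper_pos hx
  have h2 := norm_pos_of_upper hx y
  have e1 : ‖x - emb n y‖ = lastCoord n x *
      (1 + ‖(lastCoord n x)⁻¹ • (pr n x - y)‖ ^ 2) ^ ((1 : ℝ) / 2) := by
    rw [← Real.sqrt_eq_rpow]
    have := norm_sub_emb_sq H.npos x y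
    rw [← Real.sqrt_sq h2.le, this, norm_smul, ← Real.sqrt_sq hx0.le, ← Real.sqrt_mul (by positivity),
      Real.sqrt_sq hx0.le, Real.norm_of_nonneg (by positivity)]
    congr 1; field_simp; ring
  unfold Poi
  rw [e1, Real.mul_rpow (by positivity) (by positivity), ← Real.rpow_mul (by positivity),
    ← mul_assoc, Real.rpow_neg hx0.le, Real.rpow_natCast]
  have e2 : lastCoord n x * (lastCoord n x ^ n)⁻¹ = (lastCoord n x ^ (n - 1))⁻¹ := by
    obtain ⟨k, rfl⟩ : ∃ k, n = k + 1 := ⟨n - 1, by have := H.hn; omega⟩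
    rw [pow_succ]; field_simp; simp
  rw [e2]; congr 2; ring

lemma J_int (H : Par n α) :
    Integrable (fun z : Eu (n - 1) => (1 + ‖z‖ ^ 2) ^ (-(n : ℝ) / 2)) :=
  integrable_rpow_neg_one_add_norm_sq (by
      have := H.cast
      simp only [finrank_euclideanSpace, Fintype.card_fin]; linarith)

lemma Poi_int (H : Par n α) {x : Eu n} (hx : x ∈ upperHalf n) :
    Integrable (Poi n x) ∧ ∫ y, Poi n x y =
      ∫ z : Eu (n - 1), (1 + ‖z‖ ^ 2) ^ (-(n : ℝ) / 2) := by
  have hx0 := upper_pos hx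
  have hP : Poi n x = fun y => (lastCoord n x ^ (n - 1))⁻¹ *
      (1 + ‖(lastCoord n x)⁻¹ • (pr n x - y)‖ ^ 2) ^ (-(n : ℝ) / 2) := funext (Poi_eq H hx)
  rw [hP]
  constructor
  · have := ((J_int H).comp_smul (inv_ne_zero hx0.ne')).comp_sub_left (pr n x)
    exact this.const_mul _
  · rw [integral_const_mul, integral_sub_left_eq_self
      (fun y => (1 + ‖(lastCoord n x)⁻¹ • y‖ ^ 2) ^ (-(n : ℝ) / 2)) volume (pr n x),
      Measure.integral_comp_inv_smul_of_nonneg volume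
      (fun z : Eu (n - 1) => (1 + ‖z‖ ^ 2) ^ (-(n : ℝ) / 2)) hx0.le]
    simp only [finrank_euclideanSpace, Fintype.card_fin, smul_eq_mul]
    field_simp

lemma w_int (H : Par n α) {δ : ℝ} (hδ : 0 < δ) :
    Integrable (fun y : Eu (n - 1) => ‖emb n y - xo n‖ ^ (-((n : ℝ) - 1 + δ))) := by
  have h := integrable_rpow_neg_one_add_norm_sq (E := Eu (n - 1)) (μ := volume)
    (r := (n : ℝ) - 1 + δ) (by
      have := H.cast
      simp only [finrank_euclideanSpace, Fintype.card_fin]; linarith)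
  refine h.mono' ?_ ?_
  · have := (cont_emb n).measurable
    exact Measurable.aestronglyMeasurable (by fun_prop)
  · refine Filter.Eventually.of_forall fun y => ?_
    have hw := w_ge H y
    have := H.hnR
    rw [Real.norm_of_nonneg (by positivity)]
    have e : ‖emb n y - xo n‖ = (4 + ‖y‖ ^ 2) ^ ((1 : ℝ) / 2) := by
      rw [← w_eq H, ← Real.sqrt_eq_rpow, Real.sqrt_sq (norm_nonneg _)]
    rw [e, ← Real.rpow_mul (by positivity),
      show 1 / 2 * -((n : ℝ) - 1 + δ) = -((n : ℝ) - 1 + δ) / 2 by ring]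
    refine Real.rpow_le_rpow_of_nonpos (by positivity) (by linarith) (by linarith)

lemma pt_bound (H : Par n α) {δ : ℝ} (hδ : 0 < δ) {x : Eu n} (hx : x ∈ upperHalf n)
    (y : Eu (n - 1)) :
    KK n α x y * hh n α y ≤
      4 ^ kap n α * 2 ^ (n : ℝ) * (‖x - xo n‖ ^ (α - n) * Poi n x y) +
      4 ^ kap n α * 2 ^ (mm n α) * (‖x - xo n‖ ^ (α - n + δ) *
        ‖emb n y - xo n‖ ^ (-((n : ℝ) - 1 + δ))) := by
  have hx0 := upper_pos hx
  have hD := norm_pos_of_upper hx y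
  have hW := W_ge H hx
  have hw := w_ge H y
  have hxW := last_le_W H hx
  have hn := H.hnR
  have h2 := H.h2
  have hlt := H.hlt
  have t1 : ‖x - emb n y‖ ≤ ‖x - xo n‖ + ‖emb n y - xo n‖ := by
    have := norm_sub_le (x - xo n) (emb n y - xo n); simpa using this
  have t2 : ‖x - xo n‖ ≤ ‖x - emb n y‖ + ‖emb n y - xo n‖ := by
    have := norm_add_le (x - emb n y) (emb n y - xo n); simpa using this
  rw [hh_w H, KK, Poi]
  set D := ‖x - emb n y‖
  set W := ‖x - xo n‖
  set w := ‖emb n y - xo n‖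
  set s := lastCoord n x
  have hmm : mm n α = n - α + 2 := rfl
  rcases le_or_gt W (2 * w) with hc | hc
  · refine le_trans ?_ (le_add_of_nonneg_right (by positivity))
    have e1 : D ^ (-mm n α) = D ^ (-(n : ℝ)) * D ^ (α - 2) := by
      rw [← Real.rpow_add hD]; congr 1; rw [hmm]; ring
    have e2 : D ^ (α - 2) ≤ W ^ (α - 2) * w ^ (α - 2) := by
      rw [← Real.mul_rpow (by positivity) (by positivity)]
      exact Real.rpow_le_rpow (by positivity) (by nlinarith) (by linarith)
    have e3 : w ^ (α - 2) * w ^ (-((n : ℝ) + α - 4)) = w ^ (2 - (n : ℝ)) := by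
      rw [← Real.rpow_add (by linarith)]; congr 1; ring
    have e4 : w ^ (2 - (n : ℝ)) ≤ (W / 2) ^ (2 - (n : ℝ)) :=
      Real.rpow_le_rpow_of_nonpos (by linarith) (by linarith) (by linarith)
    have e5 : (W / 2) ^ (2 - (n : ℝ)) = 2 ^ ((n : ℝ) - 2) * W ^ (2 - (n : ℝ)) := by
      rw [Real.div_rpow (by linarith) (by norm_num), div_eq_mul_inv, ← Real.rpow_neg (by norm_num),
        mul_comm]; congr 2; ring
    have e6 : W ^ (α - 2) * W ^ (2 - (n : ℝ)) = W ^ (α - n) := by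
      rw [← Real.rpow_add (by linarith)]; congr 1; ring
    have e7 : (2 : ℝ) ^ ((n : ℝ) - 2) ≤ 2 ^ (n : ℝ) :=
      Real.rpow_le_rpow_of_exponent_le (by norm_num) (by linarith)
    calc s * D ^ (-mm n α) * (4 ^ kap n α * w ^ (-((n : ℝ) + α - 4)))
        = 4 ^ kap n α * (s * D ^ (-(n : ℝ))) * (D ^ (α - 2) * w ^ (-((n : ℝ) + α - 4))) := by
          rw [e1]; ring
      _ ≤ 4 ^ kap n α * (s * D ^ (-(n : ℝ))) *
          ((W ^ (α - 2) * w ^ (α - 2)) * w ^ (-((n : ℝ) + α - 4))) := by gcongr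
      _ = 4 ^ kap n α * (s * D ^ (-(n : ℝ))) * (W ^ (α - 2) * w ^ (2 - (n : ℝ))) := by
          rw [← e3]; ring
      _ ≤ 4 ^ kap n α * (s * D ^ (-(n : ℝ))) *
          (W ^ (α - 2) * (2 ^ (n : ℝ) * W ^ (2 - (n : ℝ)))) := by
          gcongr; rw [e5] at e4; exact e4.trans (by gcongr)
      _ = 4 ^ kap n α * 2 ^ (n : ℝ) * (W ^ (α - n) * (s * D ^ (-(n : ℝ)))) := by
          rw [← e6]; ring
  · refine le_trans ?_ (le_add_of_nonneg_left (by positivity))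
    have e1 : D ^ (-mm n α) ≤ 2 ^ mm n α * W ^ (-mm n α) := by
      have : D ^ (-mm n α) ≤ (W / 2) ^ (-mm n α) :=
        Real.rpow_le_rpow_of_nonpos (by linarith) (by linarith) (by linarith)
      refine this.trans (le_of_eq ?_)
      rw [Real.div_rpow (by linarith) (by norm_num), div_eq_mul_inv, ← Real.rpow_neg (by norm_num),
        mul_comm, neg_neg]
    have e2 : w ^ (-((n : ℝ) + α - 4)) = w ^ (3 - α + δ) * w ^ (-((n : ℝ) - 1 + δ)) := by
      rw [← Real.rpow_add (by linarith)]; congr 1; ring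
    have e3 : w ^ (3 - α + δ) ≤ W ^ (1 + δ) :=
      (Real.rpow_le_rpow_of_exponent_le (by linarith) (by linarith)).trans
        (Real.rpow_le_rpow (by linarith) (by linarith) (by linarith))
    have e4 : W ^ (-mm n α) * W * W ^ (1 + δ) = W ^ (α - n + δ) := by
      rw [← Real.rpow_add_one (by linarith), ← Real.rpow_add (by linarith)]; congr 1; rw [hmm]; ring
    calc s * D ^ (-mm n α) * (4 ^ kap n α * w ^ (-((n : ℝ) + α - 4)))
        ≤ W * (2 ^ mm n α * W ^ (-mm n α)) * (4 ^ kap n α *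
          (W ^ (1 + δ) * w ^ (-((n : ℝ) - 1 + δ)))) := by
          rw [e2]; gcongr
      _ = _ := by rw [← e4]; ring

lemma Op_nonneg {x : Eu n} (hx : x ∈ upperHalf n) {f : Eu (n - 1) → ℝ} (hf : ∀ y, 0 ≤ f y) :
    0 ≤ Op n α f x :=
  integral_nonneg fun y => mul_nonneg (KK_nonneg hx y) (hf y)

lemma Op_hh_bound (H : Par n α) {δ : ℝ} (hδ : 0 < δ) :
    ∃ C, 0 ≤ C ∧ ∀ x ∈ upperHalf n, Op n α (hh n α) x ≤ C * ‖x - xo n‖ ^ (α - n + δ) := by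
  set C1 := ∫ z : Eu (n - 1), (1 + ‖z‖ ^ 2) ^ (-(n : ℝ) / 2) with hC1
  set C2 := ∫ y : Eu (n - 1), ‖emb n y - xo n‖ ^ (-((n : ℝ) - 1 + δ)) with hC2
  have c1 : 0 ≤ C1 := integral_nonneg fun z => by positivity
  have c2 : 0 ≤ C2 := integral_nonneg fun z => by positivity
  refine ⟨4 ^ kap n α * 2 ^ (n : ℝ) * C1 + 4 ^ kap n α * 2 ^ (mm n α) * C2, by positivity,
    fun x hx => ?_⟩
  have hW := W_ge H hx
  obtain ⟨hPi, hPe⟩ := Poi_int H hx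
  have hwi := w_int H hδ
  have : Op n α (hh n α) x ≤ ∫ y, (4 ^ kap n α * 2 ^ (n : ℝ) * (‖x - xo n‖ ^ (α - n) * Poi n x y) +
      4 ^ kap n α * 2 ^ (mm n α) * (‖x - xo n‖ ^ (α - n + δ) *
        ‖emb n y - xo n‖ ^ (-((n : ℝ) - 1 + δ)))) := by
    refine integral_mono (hh_adm.int H hx) ?_ (pt_bound H hδ hx)
    exact ((hPi.const_mul _).const_mul _).add ((hwi.const_mul _).const_mul _)
  rw [integral_add ((hPi.const_mul _).const_mul _) ((hwi.const_mul _).const_mul _),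
    integral_const_mul, integral_const_mul, integral_const_mul, integral_const_mul, hPe,
    ← hC1, ← hC2] at this
  refine this.trans ?_
  have : ‖x - xo n‖ ^ (α - n) ≤ ‖x - xo n‖ ^ (α - n + δ) :=
    Real.rpow_le_rpow_of_exponent_le (by linarith) (by linarith)
  calc _ ≤ 4 ^ kap n α * 2 ^ (n : ℝ) * (‖x - xo n‖ ^ (α - n + δ) * C1) +
        4 ^ kap n α * 2 ^ (mm n α) * (‖x - xo n‖ ^ (α - n + δ) * C2) := by gcongr
    _ = _ := by ring

lemma meas_Op {f : Eu (n - 1) → ℝ} (hf : Measurable f) : Measurable (Op n α f) := by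
  have : StronglyMeasurable (fun z : Eu n × Eu (n - 1) => KK n α z.1 z.2 * f z.2) :=
    (meas_KK2.mul (hf.comp measurable_snd)).stronglyMeasurable
  exact this.integral_prod_right.measurable

lemma Op_hh_int (H : Par n α) :
    IntegrableOn (fun x => Op n α (hh n α) x ^ qq n α) (upperHalf n) := by
  have hlt := H.hlt
  have hn := H.hnR
  have hq := H.q_gt
  obtain ⟨C, hC, hb⟩ := Op_hh_bound H (δ := ((n : ℝ) - α) / 4) (by linarith)
  have h := integrable_one_add_norm (E := Eu n) (μ := volume)
    (r := 3 * (n : ℝ) / 2) (by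
      simp only [finrank_euclideanSpace, Fintype.card_fin]; linarith)
  refine ((h.const_mul (C ^ qq n α * 2 ^ (3 * (n : ℝ) / 2))).integrableOn (s := upperHalf n)).mono'
    (((meas_Op meas_hh).pow_const _).aestronglyMeasurable) ?_
  refine (ae_restrict_iff' (meas_upper n)).2 (Filter.Eventually.of_forall fun x hx => ?_)
  have hO := Op_nonneg (α := α) hx (fun y => (hh_pos (n := n) (α := α) y).le)
  have hW := W_ge H hx
  have hW' := W_ge' H hx
  rw [Real.norm_of_nonneg (by positivity)]
  have e : (α - n + ((n : ℝ) - α) / 4) * qq n α = - (3 * (n : ℝ) / 2) := by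
    have := H.qm
    have hmm : mm n α = n - α + 2 := rfl
    rw [hmm] at this; linarith
  calc Op n α (hh n α) x ^ qq n α ≤ (C * ‖x - xo n‖ ^ (α - n + ((n : ℝ) - α) / 4)) ^ qq n α :=
        Real.rpow_le_rpow hO (hb x hx) (by linarith)
    _ = C ^ qq n α * ‖x - xo n‖ ^ (- (3 * (n : ℝ) / 2)) := by
        rw [Real.mul_rpow hC (by positivity), ← Real.rpow_mul (by positivity), e]
    _ ≤ C ^ qq n α * ((1 + ‖x‖) / 2) ^ (- (3 * (n : ℝ) / 2)) := by
        refine mul_le_mul_of_nonneg_left ?_ (by positivity)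
        exact Real.rpow_le_rpow_of_nonpos (by positivity) (by linarith) (by linarith)
    _ = _ := by
        rw [Real.div_rpow (by positivity) (by norm_num), Real.rpow_neg (x := 2) (by norm_num)]
        field_simp

end
end HLS

namespace HLS
open EuclideanGeometry

/-- side function -/
def SS (n : ℕ) (a : Eu (n - 1)) (R : ℝ) (y : Eu (n - 1)) : ℝ :=
  (R ^ 2 - (4 + ‖a‖ ^ 2)) * (R ^ 2 - ‖y - a‖ ^ 2)

/-- sign -/
def sg (s : ℝ) : ℝ := if 0 < s then 1 else if s < 0 then -1 else 0

/-- polarization -/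
def pol (n : ℕ) (α : ℝ) (a : Eu (n - 1)) (R : ℝ) (f : Eu (n - 1) → ℝ) (y : Eu (n - 1)) : ℝ :=
  (f y + tw n α a R f y + sg (SS n a R y) * |f y - tw n α a R f y|) / 2

/-- energy -/
def Phi (n : ℕ) (α : ℝ) (f : Eu (n - 1) → ℝ) : ℝ := ∫ x in upperHalf n, Op n α f x ^ qq n α

/-- weighted norm -/
def NN (n : ℕ) (α P : ℝ) (f : Eu (n - 1) → ℝ) : ℝ := ∫ y, f y ^ P * hh n α y ^ (pp n α - P)

section
variable {n : ℕ} {α : ℝ}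

lemma sg_neg (s : ℝ) : sg (-s) = -sg s := by
  unfold sg
  rcases lt_trichotomy s 0 with h | h | h
  · simp [h, h.le, not_lt.2 h.le]
  · simp [h]
  · simp [h, h.le, not_lt.2 h.le]

lemma sg_mul {c : ℝ} (hc : 0 < c) (s : ℝ) : sg (c * s) = sg s := by
  unfold sg
  have : c * s < 0 ↔ s < 0 := by
    constructor
    · intro h; by_contra hs; push Not at hs; nlinarith [mul_nonneg hc.le hs]
    · exact mul_neg_of_pos_of_neg hc
  simp [mul_pos_iff_of_pos_left hc, this]

lemma max_half (a b : ℝ) : max a b = (a + b + |a - b|) / 2 := by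
  rcases le_total a b with h | h
  · rw [max_eq_right h, abs_of_nonpos (by linarith)]; ring
  · rw [max_eq_left h, abs_of_nonneg (by linarith)]; ring

lemma min_half (a b : ℝ) : min a b = (a + b - |a - b|) / 2 := by
  rcases le_total a b with h | h
  · rw [min_eq_left h, abs_of_nonpos (by linarith)]; ring
  · rw [min_eq_right h, abs_of_nonneg (by linarith)]; ring

lemma meas_sg : Measurable sg :=
  Measurable.ite measurableSet_Ioi measurable_const
    (Measurable.ite measurableSet_Iio measurable_const measurable_const)

lemma meas_SS (a : Eu (n - 1)) (R : ℝ) : Measurable (SS n a R) := by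
  unfold SS; fun_prop

lemma meas_pol (a : Eu (n - 1)) (R : ℝ) {f : Eu (n - 1) → ℝ} (hf : Measurable f) :
    Measurable (pol n α a R f) := by
  unfold pol
  have h1 := meas_tw (α := α) a R hf
  have h2 := meas_sg.comp (meas_SS a R)
  have h3 : Measurable fun y => |f y - tw n α a R f y| := (hf.sub h1).abs
  exact ((hf.add h1).add (h2.mul h3)).div_const 2

lemma SS_inv {y a : Eu (n - 1)} {R : ℝ} (hR : 0 < R) (hy : y ≠ a) :
    sg (SS n a R (inversion a R y)) = -sg (SS n a R y) := by
  have h3 : 0 < ‖y - a‖ := norm_pos_iff.2 (sub_ne_zero.2 hy)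
  rw [← sg_neg, ← sg_mul (c := (R / ‖y - a‖) ^ 2) (by positivity) (-SS n a R y)]
  congr 1
  unfold SS
  rw [norm_inv_center]
  field_simp
  ring

lemma tw_add (a : Eu (n - 1)) (R : ℝ) (f g : Eu (n - 1) → ℝ) (y) :
    tw n α a R (fun y => f y + g y) y = tw n α a R f y + tw n α a R g y := by
  unfold tw; ring

lemma tw_sub (a : Eu (n - 1)) (R : ℝ) (f g : Eu (n - 1) → ℝ) (y) :
    tw n α a R (fun y => f y - g y) y = tw n α a R f y - tw n α a R g y := by
  unfold tw; ring

lemma tw_pol {y a : Eu (n - 1)} {R : ℝ} (hR : 0 < R) (hy : y ≠ a) (f : Eu (n - 1) → ℝ) :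
    tw n α a R (pol n α a R f) y =
      (f y + tw n α a R f y - sg (SS n a R y) * |f y - tw n α a R f y|) / 2 := by
  have h3 : 0 < ‖y - a‖ := norm_pos_iff.2 (sub_ne_zero.2 hy)
  have e := tw_tw (α := α) hR hy f
  have hc : 0 ≤ (R / ‖y - a‖) ^ (2 * kap n α) := by positivity
  rw [tw] at e
  rw [tw, pol, SS_inv hR hy]
  have e2 : tw n α a R f y = (R / ‖y - a‖) ^ (2 * kap n α) * f (inversion a R y) := rfl
  have e3 : |f y - tw n α a R f y| = (R / ‖y - a‖) ^ (2 * kap n α) *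
      |f (inversion a R y) - tw n α a R f (inversion a R y)| := by
    rw [e2, ← e, abs_sub_comm, ← mul_sub, abs_mul, abs_of_nonneg hc]
  rw [e3, e2]
  linear_combination e / 2

lemma tw_nonneg {a y : Eu (n - 1)} {R : ℝ} (hR : 0 < R) {f : Eu (n - 1) → ℝ} (hf : ∀ y, 0 ≤ f y) :
    0 ≤ tw n α a R f y := mul_nonneg (by positivity) (hf _)

lemma tw_fix {y a : Eu (n - 1)} {R : ℝ} (hR : 0 < R) (h : ‖y - a‖ = R) (f : Eu (n - 1) → ℝ) :
    tw n α a R f y = f y := by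
  unfold tw
  rw [inversion_of_mem_sphere (by simpa [dist_eq_norm] using h), h, div_self hR.ne']
  simp

lemma tw_of_SS {y a : Eu (n - 1)} {R : ℝ} (hR : 0 < R) (hc : R ^ 2 - (4 + ‖a‖ ^ 2) ≠ 0)
    (h : SS n a R y = 0) (f : Eu (n - 1) → ℝ) :
    tw n α a R f y = f y := by
  apply tw_fix hR
  rcases mul_eq_zero.1 h with h | h
  · exact absurd h hc
  · have : ‖y - a‖ ^ 2 = R ^ 2 := by linarith
    exact (sq_eq_sq₀ (norm_nonneg _) hR.le).1 this

lemma pol_pos {y a : Eu (n - 1)} {R : ℝ} (h : 0 < SS n a R y) (f : Eu (n - 1) → ℝ) :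
    pol n α a R f y = max (f y) (tw n α a R f y) := by
  rw [pol, sg, if_pos h, max_half]; ring_nf

lemma pol_neg {y a : Eu (n - 1)} {R : ℝ} (h : SS n a R y < 0) (f : Eu (n - 1) → ℝ) :
    pol n α a R f y = min (f y) (tw n α a R f y) := by
  rw [pol, sg, if_neg (not_lt.2 h.le), if_pos h, min_half]; ring_nf

lemma pol_zero {y a : Eu (n - 1)} {R : ℝ} (hR : 0 < R) (hc : R ^ 2 - (4 + ‖a‖ ^ 2) ≠ 0)
    (h : SS n a R y = 0) (f : Eu (n - 1) → ℝ) :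
    pol n α a R f y = f y := by
  rw [pol, tw_of_SS hR hc h]; simp

lemma tw_pol_pos {y a : Eu (n - 1)} {R : ℝ} (hR : 0 < R) (hy : y ≠ a)
    (h : 0 < SS n a R y) (f : Eu (n - 1) → ℝ) :
    tw n α a R (pol n α a R f) y = min (f y) (tw n α a R f y) := by
  rw [tw_pol hR hy, sg, if_pos h, min_half]; ring_nf

lemma tw_pol_neg {y a : Eu (n - 1)} {R : ℝ} (hR : 0 < R) (hy : y ≠ a)
    (h : SS n a R y < 0) (f : Eu (n - 1) → ℝ) :
    tw n α a R (pol n α a R f) y = max (f y) (tw n α a R f y) := by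
  rw [tw_pol hR hy, sg, if_neg (not_lt.2 h.le), if_pos h, max_half]; ring_nf

lemma tw_hh_lt (H : Par n α) {y a : Eu (n - 1)} {R : ℝ} (hR : 0 < R) (hy : y ≠ a)
    (h : 0 < SS n a R y) : tw n α a R (hh n α) y < hh n α y := by
  obtain ⟨hD, e⟩ := tw_hh H hR hy
  rw [e, hh]
  have : 0 < SS n a R y / R ^ 2 := by positivity
  unfold SS at this
  refine Real.rpow_lt_rpow (by positivity) ?_ H.kap_pos
  exact div_lt_div_of_pos_left (by norm_num) (by positivity) (by linarith)

lemma hh_lt_tw (H : Par n α) {y a : Eu (n - 1)} {R : ℝ} (hR : 0 < R) (hy : y ≠ a)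
    (h : SS n a R y < 0) : hh n α y < tw n α a R (hh n α) y := by
  obtain ⟨hD, e⟩ := tw_hh H hR hy
  rw [e, hh]
  have : SS n a R y / R ^ 2 < 0 := div_neg_of_neg_of_pos h (by positivity)
  unfold SS at this
  refine Real.rpow_lt_rpow (by positivity) ?_ H.kap_pos
  exact div_lt_div_of_pos_left (by norm_num) (by positivity) (by linarith)

lemma tw_center (H : Par n α) (a : Eu (n - 1)) (R : ℝ) (f : Eu (n - 1) → ℝ) :
    tw n α a R f a = 0 := by
  unfold tw; simp [H.kap_pos.ne']

lemma tw_le_hh {a y : Eu (n - 1)} {R M : ℝ} (hR : 0 < R)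
    {f : Eu (n - 1) → ℝ} (hf : Adm n α M f) :
    tw n α a R f y ≤ M * tw n α a R (hh n α) y := by
  unfold tw
  have := mul_le_mul_of_nonneg_left (hf.le (inversion a R y))
    (show 0 ≤ (R / ‖y - a‖) ^ (2 * kap n α) by positivity)
  linarith

lemma pol_adm (H : Par n α) {a : Eu (n - 1)} {R M : ℝ} (hR : 0 < R) (hM : 0 ≤ M)
    (hc : R ^ 2 - (4 + ‖a‖ ^ 2) ≠ 0)
    {f : Eu (n - 1) → ℝ} (hf : Adm n α M f) : Adm n α M (pol n α a R f) := by
  refine ⟨meas_pol a R hf.meas, fun y => ?_, fun y => ?_⟩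
  · rcases lt_trichotomy (SS n a R y) 0 with h | h | h
    · rw [pol_neg h]; exact le_min (hf.nonneg y) (tw_nonneg hR hf.nonneg)
    · rw [pol_zero hR hc h]; exact hf.nonneg y
    · rw [pol_pos h]; exact le_max_of_le_left (hf.nonneg y)
  · rcases lt_trichotomy (SS n a R y) 0 with h | h | h
    · rw [pol_neg h]; exact (min_le_left _ _).trans (hf.le y)
    · rw [pol_zero hR hc h]; exact hf.le y
    · rw [pol_pos h]
      refine max_le (hf.le y) ?_
      by_cases hy : y = a
      · subst hy; rw [tw_center H]; exact mul_nonneg hM (hh_pos _).le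
      · exact (tw_le_hh hR hf).trans (mul_le_mul_of_nonneg_left (tw_hh_lt H hR hy h).le hM)

/-- sign lemma -/
lemma Op_sign (H : Par n α) {x : Eu n} (hx : x ∈ upperHalf n) {a : Eu (n - 1)} {R : ℝ}
    (hR : 0 < R) (hc : R ^ 2 - (4 + ‖a‖ ^ 2) ≠ 0) {ψ : Eu (n - 1) → ℝ}
    (h1 : Integrable (fun y => KK n α x y * ψ y))
    (h1' : Integrable (fun y => KK n α (inversion (emb n a) R x) y * ψ y))
    (h2 : ∀ y, y ≠ a → tw n α a R ψ y = -ψ y)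
    (h3 : ∀ y, 0 < SS n a R y → 0 ≤ ψ y) (h4 : ∀ y, SS n a R y < 0 → ψ y ≤ 0)
    (h5 : ∀ y, SS n a R y = 0 → ψ y = 0) :
    (0 ≤ (R ^ 2 - (4 + ‖a‖ ^ 2)) * (R ^ 2 - ‖x - emb n a‖ ^ 2) → 0 ≤ Op n α ψ x) ∧
    ((R ^ 2 - (4 + ‖a‖ ^ 2)) * (R ^ 2 - ‖x - emb n a‖ ^ 2) ≤ 0 → Op n α ψ x ≤ 0) := by
  have hK := int_Kt H hx a hR h1'
  have e1 : Op n α ψ x = - ∫ y, Kt n α a R x y * ψ y := by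
    rw [Op_eq_Kt H x a hR, ← integral_neg]
    apply integral_congr_ae
    filter_upwards [ae_ne H.n1pos a] with y hy
    rw [h2 y hy]; ring
  have e2 : 2 * Op n α ψ x = ∫ y, (KK n α x y - Kt n α a R x y) * ψ y := by
    have : ∫ y, (KK n α x y - Kt n α a R x y) * ψ y =
        (∫ y, KK n α x y * ψ y) - ∫ y, Kt n α a R x y * ψ y := by
      rw [← integral_sub h1 hK]; congr 1; ext y; ring
    rw [this]
    have e3 : (∫ y, KK n α x y * ψ y) = Op n α ψ x := rfl
    rw [e3]; linarith
  constructor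
  · intro hA
    have : 0 ≤ ∫ y, (KK n α x y - Kt n α a R x y) * ψ y := by
      apply integral_nonneg_of_ae
      filter_upwards [ae_ne H.n1pos a] with y hy
      show 0 ≤ (KK n α x y - Kt n α a R x y) * ψ y
      rcases lt_trichotomy (SS n a R y) 0 with h | h | h
      · refine mul_nonneg_of_nonpos_of_nonpos ?_ (h4 y h)
        rw [sub_nonpos]
        apply le_Kt H hx hR hy
        unfold SS at h
        by_contra hh
        push Not at hh
        have := mul_nonneg hA hh.le
        nlinarith [mul_pos_iff.1 hh, sq_nonneg (R ^ 2 - ‖x - emb n a‖ ^ 2), mul_neg_of_neg_of_pos h (show 0 < (R ^ 2 - ‖x - emb n a‖ ^ 2)^2 by rcases mul_pos_iff.1 hh with h | h <;> nlinarith)]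
      · rw [h5 y h]; simp
      · refine mul_nonneg ?_ (h3 y h)
        rw [sub_nonneg]
        apply Kt_le H hx hR hy
        unfold SS at h
        by_contra hh
        push Not at hh
        have := mul_nonneg hA (neg_pos.2 hh).le
        nlinarith [mul_pos h (show 0 < (R ^ 2 - ‖x - emb n a‖ ^ 2)^2 by rcases mul_neg_iff.1 hh with h | h <;> nlinarith)]
    linarith
  · intro hA
    have : ∫ y, (KK n α x y - Kt n α a R x y) * ψ y ≤ 0 := by
      apply integral_nonpos_of_ae
      filter_upwards [ae_ne H.n1pos a] with y hy
      show (KK n α x y - Kt n α a R x y) * ψ y ≤ 0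
      rcases lt_trichotomy (SS n a R y) 0 with h | h | h
      · refine mul_nonpos_of_nonneg_of_nonpos ?_ (h4 y h)
        rw [sub_nonneg]
        apply Kt_le H hx hR hy
        unfold SS at h
        by_contra hh
        push Not at hh
        have := mul_nonneg (neg_nonneg.2 hA) (neg_pos.2 hh).le
        nlinarith [mul_neg_of_neg_of_pos h (show 0 < (R ^ 2 - ‖x - emb n a‖ ^ 2)^2 by rcases mul_neg_iff.1 hh with h | h <;> nlinarith)]
      · rw [h5 y h]; simp
      · refine mul_nonpos_of_nonpos_of_nonneg ?_ (h3 y h)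
        rw [sub_nonpos]
        apply le_Kt H hx hR hy
        unfold SS at h
        by_contra hh
        push Not at hh
        have := mul_nonneg (neg_nonneg.2 hA) hh.le
        nlinarith [mul_pos h (show 0 < (R ^ 2 - ‖x - emb n a‖ ^ 2)^2 by rcases mul_pos_iff.1 hh with h | h <;> nlinarith)]
    linarith

lemma conv_swap {a b a' b' q : ℝ} (hq : 1 ≤ q) (ha' : 0 ≤ a') (hb' : 0 ≤ b')
    (h : a + b = a' + b') (hs : 0 ≤ (a' - a) * (a' - b)) : a ^ q + b ^ q ≤ a' ^ q + b' ^ q := by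
  by_cases hab : a' = b'
  · subst hab
    have e : a = a' := by
      have : (a' - a) ^ 2 ≤ 0 := by
        have : b = a' + a' - a := by linarith
        subst this; nlinarith
      nlinarith [sq_nonneg (a' - a)]
    subst e
    have : b = a := by linarith
    rw [this]
  · have hd : a' - b' ≠ 0 := sub_ne_zero.2 hab
    have hd2 : 0 < (a' - b') ^ 2 := by positivity
    set t := (a - b') / (a' - b') with ht
    have htm : t * (a' - b') = a - b' := div_mul_cancel₀ _ hd
    have ht0 : 0 ≤ t * (1 - t) := by
      have : t * (1 - t) * (a' - b') ^ 2 = (a' - a) * (a' - b) := by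
        have e : b = a' + b' - a := by linarith
        rw [e]
        linear_combination (-(a - b') - t * (a' - b') + (a' - b')) * htm
      by_contra hh
      push Not at hh
      have := mul_neg_of_neg_of_pos hh hd2
      linarith
    have ht1 : 0 ≤ t ∧ 0 ≤ 1 - t := by
      constructor <;> by_contra hh <;> push Not at hh <;> nlinarith
    have C := (convexOn_rpow hq).2
    have c1 := C (Set.mem_Ici.2 ha') (Set.mem_Ici.2 hb') ht1.1 ht1.2 (by ring)
    have c2 := C (Set.mem_Ici.2 hb') (Set.mem_Ici.2 ha') ht1.1 ht1.2 (by ring)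
    simp only [smul_eq_mul] at c1 c2
    have e1 : t * a' + (1 - t) * b' = a := by linear_combination htm
    have e2 : t * b' + (1 - t) * a' = b := by linear_combination -htm - h
    rw [e1] at c1; rw [e2] at c2
    linarith

lemma Op_le_hh (H : Par n α) {M : ℝ} {f : Eu (n - 1) → ℝ} (hf : Adm n α M f) {x : Eu n}
    (hx : x ∈ upperHalf n) : Op n α f x ≤ M * Op n α (hh n α) x := by
  unfold Op
  rw [← integral_const_mul]
  refine integral_mono (hf.int H hx) ((hh_adm.int H hx).const_mul M) fun y => ?_
  have := mul_le_mul_of_nonneg_left (hf.le y) (KK_nonneg (α := α) hx y)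
  show _ ≤ M * (KK n α x y * hh n α y)
  linarith

lemma Op_q_le (H : Par n α) {M : ℝ} {f : Eu (n - 1) → ℝ} (hM : 0 ≤ M) (hf : Adm n α M f) {x : Eu n}
    (hx : x ∈ upperHalf n) : Op n α f x ^ qq n α ≤ M ^ qq n α * Op n α (hh n α) x ^ qq n α := by
  rw [← Real.mul_rpow hM (Op_nonneg hx (fun y => (hh_pos y).le))]
  exact Real.rpow_le_rpow (Op_nonneg hx hf.nonneg) (Op_le_hh H hf hx) (by linarith [H.q_gt])

lemma Op_q_int (H : Par n α) {M : ℝ} {f : Eu (n - 1) → ℝ} (hM : 0 ≤ M) (hf : Adm n α M f) :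
    IntegrableOn (fun x => Op n α f x ^ qq n α) (upperHalf n) := by
  refine Integrable.mono' ((Op_hh_int H).const_mul (M ^ qq n α))
    ((meas_Op hf.meas).pow_const _).aestronglyMeasurable ?_
  refine (ae_restrict_iff' (meas_upper n)).2 (Filter.Eventually.of_forall fun x hx => ?_)
  rw [Real.norm_of_nonneg (Real.rpow_nonneg (Op_nonneg hx hf.nonneg) _)]
  exact Op_q_le H hM hf hx

lemma ind_tw (H : Par n α) (a : Eu (n - 1)) {R : ℝ} (hR : 0 < R) {f : Eu (n - 1) → ℝ}
    (hf : ∀ y, 0 ≤ f y) (w : Eu n) :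
    (upperHalf n).indicator (fun x => Op n α (tw n α a R f) x ^ qq n α) w =
    ((R / ‖w - emb n a‖) ^ 2) ^ n *
      (upperHalf n).indicator (fun x => Op n α f x ^ qq n α) (inversion (emb n a) R w) := by
  by_cases hw : w ∈ upperHalf n
  · have hw' := inv_upper H hw a hR
    have h1 := norm_pos_of_upper hw a
    rw [Set.indicator_of_mem hw, Set.indicator_of_mem hw', Op_tw H hw a hR,
      Real.mul_rpow (by positivity) (Op_nonneg hw' hf), ← Real.rpow_mul (by positivity), H.qm,
      pow_rpow _ (by positivity)]
  · have hw' : inversion (emb n a) R w ∉ upperHalf n := by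
      intro h
      apply hw
      have : 0 < lastCoord n (inversion (emb n a) R w) := h
      rw [last_inversion] at this
      exact pos_of_mul_pos_right this (by positivity)
    rw [Set.indicator_of_notMem hw, Set.indicator_of_notMem hw', mul_zero]

lemma Phi_tw (H : Par n α) (a : Eu (n - 1)) {R M : ℝ} (hR : 0 < R) {f : Eu (n - 1) → ℝ}
    (hM : 0 ≤ M) (hf : Adm n α M f) :
    IntegrableOn (fun x => Op n α (tw n α a R f) x ^ qq n α) (upperHalf n) ∧
    Phi n α (tw n α a R f) = Phi n α f := by
  constructor
  · rw [← integrable_indicator_iff (meas_upper n), funext (ind_tw H a hR hf.nonneg),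
      ← inv_integrable H.npos (emb n a) hR, integrable_indicator_iff (meas_upper n)]
    exact Op_q_int H hM hf
  · unfold Phi
    rw [← integral_indicator (meas_upper n), ← integral_indicator (meas_upper n),
      funext (ind_tw H a hR hf.nonneg), ← inv_integral H.npos (emb n a) hR]

lemma Op_sub {f g : Eu (n - 1) → ℝ} {x : Eu n} (hf : Integrable (fun y => KK n α x y * f y))
    (hg : Integrable (fun y => KK n α x y * g y)) :
    Op n α (fun y => f y - g y) x = Op n α f x - Op n α g x := by
  unfold Op; rw [← integral_sub hf hg]; congr 1; ext y; ring

lemma Op_add {f g : Eu (n - 1) → ℝ} {x : Eu n} (hf : Integrable (fun y => KK n α x y * f y))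
    (hg : Integrable (fun y => KK n α x y * g y)) :
    Op n α (fun y => f y + g y) x = Op n α f x + Op n α g x := by
  unfold Op; rw [← integral_add hf hg]; congr 1; ext y; ring

lemma int_sub' {f g : Eu (n - 1) → ℝ} {x : Eu n} (hf : Integrable (fun y => KK n α x y * f y))
    (hg : Integrable (fun y => KK n α x y * g y)) :
    Integrable (fun y => KK n α x y * (f y - g y)) :=
  (hf.sub hg).congr (Filter.Eventually.of_forall fun y => by simp; ring)

lemma tw_zero_center (H : Par n α) {a : Eu (n - 1)} {R : ℝ} (f : Eu (n - 1) → ℝ) : 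
    tw n α a R f a = 0 := tw_center H a R f

lemma Phi_pol (H : Par n α) (a : Eu (n - 1)) {R M : ℝ} (hR : 0 < R) {f : Eu (n - 1) → ℝ}
    (hc : R ^ 2 - (4 + ‖a‖ ^ 2) ≠ 0) (hM : 0 ≤ M) (hf : Adm n α M f) :
    Phi n α f ≤ Phi n α (pol n α a R f) := by
  have hp := pol_adm H hR hM hc hf
  obtain ⟨i1, e1⟩ := Phi_tw H a hR hM hf
  obtain ⟨i2, e2⟩ := Phi_tw H a hR hM hp
  have i3 := Op_q_int H hM hf
  have i4 := Op_q_int H hM hp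
  have key : ∀ x ∈ upperHalf n, Op n α f x ^ qq n α + Op n α (tw n α a R f) x ^ qq n α ≤
      Op n α (pol n α a R f) x ^ qq n α + Op n α (tw n α a R (pol n α a R f)) x ^ qq n α := by
    intro x hx
    have hx' := inv_upper H hx a hR
    have hx'' : inversion (emb n a) R (inversion (emb n a) R x) ∈ upperHalf n :=
      inv_upper H hx' a hR
    have I1 := hf.int H hx
    have I1' := hf.int H hx'
    have I2 := int_tw H hx a hR I1'
    have I2' := int_tw H hx' a hR (hf.int H hx'')
    have I3 := hp.int H hx
    have I3' := hp.int H hx'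
    have I4 := int_tw H hx a hR I3'
    apply conv_swap H.q_gt.le (Op_nonneg hx hp.nonneg)
      (Op_nonneg hx (fun y => tw_nonneg hR hp.nonneg))
    · rw [← Op_add I1 I2, ← Op_add I3 I4]
      unfold Op
      apply integral_congr_ae
      filter_upwards [ae_ne H.n1pos a] with y hy
      rw [tw_pol hR hy, pol]; ring
    · rw [← Op_sub I3 I1, ← Op_sub I3 I2]
      have s1 := Op_sign H hx hR hc (int_sub' I3 I1) (int_sub' I3' I1')
        (fun y hy => by rw [tw_sub, tw_pol hR hy, pol]; ring)
        (fun y h => by rw [pol_pos h]; simp)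
        (fun y h => by rw [pol_neg h]; simp)
        (fun y h => by rw [pol_zero hR hc h]; simp)
      have s2 := Op_sign H hx hR hc (int_sub' I3 I2) (int_sub' I3' I2')
        (fun y hy => by rw [tw_sub, tw_pol hR hy, tw_tw hR hy, pol]; ring)
        (fun y h => by rw [pol_pos h]; simp)
        (fun y h => by rw [pol_neg h]; simp)
        (fun y h => by rw [pol_zero hR hc h, tw_of_SS hR hc h]; simp)
      rcases le_total 0 ((R ^ 2 - (4 + ‖a‖ ^ 2)) * (R ^ 2 - ‖x - emb n a‖ ^ 2)) with h | h
      · exact mul_nonneg (s1.1 h) (s2.1 h)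
      · exact mul_nonneg_of_nonpos_of_nonpos (s1.2 h) (s2.2 h)
  have := setIntegral_mono_on (i3.add i1) (i4.add i2) (meas_upper n) key
  simp only [Pi.add_apply] at this
  rw [integral_add i3 i1, integral_add i4 i2] at this
  unfold Phi at e1 e2 ⊢
  linarith

/-! ### the weighted norm -/

lemma NN_int (H : Par n α) {M P : ℝ} (hM : 0 ≤ M) (hP : 0 < P) {f : Eu (n - 1) → ℝ}
    (hf : Adm n α M f) : Integrable (fun y => f y ^ P * hh n α y ^ (pp n α - P)) := by
  refine Integrable.mono' ((hh_p_int H).const_mul (M ^ P))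
    ((hf.meas.pow_const _).mul (meas_hh.pow_const _)).aestronglyMeasurable ?_
  refine Filter.Eventually.of_forall fun y => ?_
  have h0 := hh_pos (α := α) y
  have h1 := hf.nonneg y
  rw [Real.norm_of_nonneg (by positivity)]
  have := Real.rpow_le_rpow h1 (hf.le y) hP.le
  rw [Real.mul_rpow hM h0.le] at this
  calc _ ≤ M ^ P * hh n α y ^ P * hh n α y ^ (pp n α - P) := by gcongr
    _ = _ := by rw [mul_assoc, ← Real.rpow_add h0]; ring_nf

lemma NN_tw_pt (H : Par n α) {P : ℝ} {a y : Eu (n - 1)} {R : ℝ} (hR : 0 < R) (hy : y ≠ a)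
    {f : Eu (n - 1) → ℝ} (hf : ∀ y, 0 ≤ f y) :
    tw n α a R f y ^ P * tw n α a R (hh n α) y ^ (pp n α - P) =
      ((R / ‖y - a‖) ^ 2) ^ (n - 1) *
      (f (inversion a R y) ^ P * hh n α (inversion a R y) ^ (pp n α - P)) := by
  have h3 : 0 < ‖y - a‖ := norm_pos_iff.2 (sub_ne_zero.2 hy)
  unfold tw
  have hc : 0 < R / ‖y - a‖ := by positivity
  rw [Real.mul_rpow (by positivity) (hf _), Real.mul_rpow (by positivity) (hh_pos _).le,
    pow_rpow _ hc.le, H.cast, ← H.kp,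
    show 2 * (kap n α * pp n α) = (2 * kap n α) * P + (2 * kap n α) * (pp n α - P) by ring,
    Real.rpow_add hc, Real.rpow_mul hc.le (2 * kap n α) P,
    Real.rpow_mul hc.le (2 * kap n α) (pp n α - P)]
  generalize ((R / ‖y - a‖) ^ (2 * kap n α)) = c
  ring

lemma NN_tw (H : Par n α) {M P : ℝ} (hM : 0 ≤ M) (hP : 0 < P) (a : Eu (n - 1)) {R : ℝ}
    (hR : 0 < R) {f : Eu (n - 1) → ℝ} (hf : Adm n α M f) :
    Integrable (fun y => tw n α a R f y ^ P * tw n α a R (hh n α) y ^ (pp n α - P)) ∧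
    ∫ y, tw n α a R f y ^ P * tw n α a R (hh n α) y ^ (pp n α - P) = NN n α P f := by
  have I := NN_int H hM hP hf
  constructor
  · rw [inv_integrable H.n1pos a hR] at I
    refine I.congr ?_
    filter_upwards [ae_ne H.n1pos a] with y hy using (NN_tw_pt H hR hy hf.nonneg).symm
  · unfold NN
    rw [inv_integral H.n1pos a hR (fun y => f y ^ P * hh n α y ^ (pp n α - P))]
    apply integral_congr_ae
    filter_upwards [ae_ne H.n1pos a] with y hy using NN_tw_pt H hR hy hf.nonneg

lemma NN_pol (H : Par n α) {M P : ℝ} (hM : 0 ≤ M) (hP : pp n α < P) (a : Eu (n - 1)) {R : ℝ}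
    (hR : 0 < R) (hc : R ^ 2 - (4 + ‖a‖ ^ 2) ≠ 0) {f : Eu (n - 1) → ℝ} (hf : Adm n α M f) :
    NN n α P (pol n α a R f) ≤ NN n α P f ∧
    (NN n α P (pol n α a R f) = NN n α P f → ∀ᵐ y, pol n α a R f y = f y) := by
  have hP0 : 0 < P := by linarith [H.p_gt]
  have hp := pol_adm H hR hM hc hf
  obtain ⟨i1, e1⟩ := NN_tw H hM hP0 a hR hf
  obtain ⟨i2, e2⟩ := NN_tw H hM hP0 a hR hp
  have i3 := NN_int H hM hP0 hf
  have i4 := NN_int H hM hP0 hp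
  set D : Eu (n - 1) → ℝ := fun y =>
    (f y ^ P * hh n α y ^ (pp n α - P) +
      tw n α a R f y ^ P * tw n α a R (hh n α) y ^ (pp n α - P)) -
    (pol n α a R f y ^ P * hh n α y ^ (pp n α - P) +
      tw n α a R (pol n α a R f) y ^ P * tw n α a R (hh n α) y ^ (pp n α - P)) with hD
  have iD : Integrable D := (i3.add i1).sub (i4.add i2)
  have eD : ∫ y, D y = 2 * (NN n α P f - NN n α P (pol n α a R f)) := by
    have : ∫ y, D y = (NN n α P f + NN n α P f) -
        (NN n α P (pol n α a R f) + NN n α P (pol n α a R f)) := by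
      nth_rewrite 2 [← e1]
      nth_rewrite 2 [← e2]
      simp only [NN]
      rw [← integral_add i3 i1, ← integral_add i4 i2]
      exact integral_sub (i3.add i1) (i4.add i2)
    rw [this]; ring
  have pt : ∀ y, y ≠ a → 0 ≤ D y ∧ (D y = 0 → pol n α a R f y = f y) := by
    intro y hy
    have h0 := hh_pos (α := α) y
    have h3 : 0 < ‖y - a‖ := norm_pos_iff.2 (sub_ne_zero.2 hy)
    have h0' : 0 < tw n α a R (hh n α) y := mul_pos (by positivity) (hh_pos _)
    have hf0 := hf.nonneg y
    have ht0 : 0 ≤ tw n α a R f y := tw_nonneg hR hf.nonneg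
    rcases lt_trichotomy (SS n a R y) 0 with h | h | h
    · have hl := hh_lt_tw H hR hy h
      have hl2 := Real.rpow_lt_rpow_of_neg h0 hl (show pp n α - P < 0 by linarith)
      rcases le_or_gt (f y) (tw n α a R f y) with hft | hft
      · have ep : pol n α a R f y = f y := by rw [pol_neg h, min_eq_left hft]
        refine ⟨?_, fun _ => ep⟩
        simp only [hD]
        rw [ep, tw_pol_neg hR hy h, max_eq_right hft]; simp
      · have hl3 := Real.rpow_lt_rpow ht0 hft hP0
        have : 0 < D y := by
          simp only [hD]
          rw [pol_neg h, tw_pol_neg hR hy h, max_eq_left hft.le, min_eq_right hft.le]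
          nlinarith
        exact ⟨this.le, fun h => absurd h this.ne'⟩
    · have ep := pol_zero hR hc h (α := α) f
      refine ⟨?_, fun _ => ep⟩
      simp only [hD]
      rw [ep, tw_of_SS hR hc h, tw_of_SS hR hc h, tw_of_SS hR hc h, ep]; simp
    · have hl := tw_hh_lt H hR hy h
      have hl2 := Real.rpow_lt_rpow_of_neg h0' hl (show pp n α - P < 0 by linarith)
      rcases le_or_gt (tw n α a R f y) (f y) with hft | hft
      · have ep : pol n α a R f y = f y := by rw [pol_pos h, max_eq_left hft]
        refine ⟨?_, fun _ => ep⟩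
        simp only [hD]
        rw [ep, tw_pol_pos hR hy h, min_eq_right hft]; simp
      · have hl3 := Real.rpow_lt_rpow hf0 hft hP0
        have : 0 < D y := by
          simp only [hD]
          rw [pol_pos h, tw_pol_pos hR hy h, max_eq_right hft.le, min_eq_left hft.le]
          nlinarith
        exact ⟨this.le, fun h => absurd h this.ne'⟩
  have hD0 : 0 ≤ᵐ[volume] D := by
    filter_upwards [ae_ne H.n1pos a] with y hy using (pt y hy).1
  constructor
  · have := integral_nonneg_of_ae hD0
    linarith
  · intro h
    have : ∫ y, D y = 0 := by rw [eD, h]; ring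
    rw [integral_eq_zero_iff_of_nonneg_ae hD0 iD] at this
    filter_upwards [this, ae_ne H.n1pos a] with y h1 hy using (pt y hy).2 h1

end
end HLS

namespace HLS
open EuclideanGeometry

/-- radius of the reflection spheres -/
def RR {k : ℕ} (β : ℝ) (a : Eu k) : ℝ := Real.sqrt (β + ‖a‖ ^ 2)

section
variable {n : ℕ} {α : ℝ}

lemma RR_pos {k : ℕ} {β : ℝ} (hβ : 0 < β) (a : Eu k) : 0 < RR β a :=
  Real.sqrt_pos.2 (by positivity)

lemma RR_sq {k : ℕ} {β : ℝ} (hβ : 0 < β) (a : Eu k) : RR β a ^ 2 = β + ‖a‖ ^ 2 :=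
  Real.sq_sqrt (by positivity)

lemma RR_meas {k : ℕ} (β : ℝ) : Measurable (RR (k := k) β) := by unfold RR; fun_prop

lemma geo {k : ℕ} {β : ℝ} (hβ : 0 < β) (y z : Eu k) (h : ‖y‖ ≠ ‖z‖) :
    ∃ a : Eu k, y ≠ a ∧ inversion a (RR β a) y = z ∧
      (RR β a / ‖y - a‖) ^ 2 = (β + ‖z‖ ^ 2) / (β + ‖y‖ ^ 2) ∧
      0 < (RR β a ^ 2 - ‖y - a‖ ^ 2) * (‖z‖ ^ 2 - ‖y‖ ^ 2) := by
  have hne : ‖y‖ ^ 2 - ‖z‖ ^ 2 ≠ 0 := by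
    intro h'
    exact h ((sq_eq_sq₀ (norm_nonneg _) (norm_nonneg _)).1 (by linarith))
  have hy : 0 < β + ‖y‖ ^ 2 := by positivity
  set s := (β + ‖y‖ ^ 2) / (‖y‖ ^ 2 - ‖z‖ ^ 2) with hs
  have hs0 : s ≠ 0 := div_ne_zero hy.ne' hne
  have hsm : s * (‖y‖ ^ 2 - ‖z‖ ^ 2) = β + ‖y‖ ^ 2 := div_mul_cancel₀ _ hne
  have hyz : z - y ≠ 0 := by
    intro h'; rw [sub_eq_zero] at h'; exact h (by rw [h'])
  have hd : 0 < ‖z - y‖ ^ 2 := by have := norm_pos_iff.2 hyz; positivity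
  set a := y + s • (z - y) with ha
  have hya : y - a = -(s • (z - y)) := by rw [ha]; abel
  have hna : ‖y - a‖ ^ 2 = s ^ 2 * ‖z - y‖ ^ 2 := by
    rw [hya, norm_neg, norm_smul, mul_pow, Real.norm_eq_abs, sq_abs]
  have hR : RR β a ^ 2 = s * (s - 1) * ‖z - y‖ ^ 2 := by
    rw [RR_sq hβ, ha, norm_add_sq_real, real_inner_smul_right, norm_smul, mul_pow,
      Real.norm_eq_abs, sq_abs]
    have e : ‖z - y‖ ^ 2 = ‖z‖ ^ 2 - ‖y‖ ^ 2 - 2 * inner ℝ y (z - y) := by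
      rw [inner_sub_right, real_inner_self_eq_norm_sq, norm_sub_sq_real, real_inner_comm]; ring
    linear_combination -hsm + s * e
  have hne2 : y ≠ a := by
    intro h'
    have := sub_eq_zero.2 h'
    rw [hya, neg_eq_zero, smul_eq_zero] at this
    exact this.elim hs0 hyz
  have hrho : (RR β a / ‖y - a‖) ^ 2 = (s - 1) / s := by
    rw [div_pow, hR, hna]; field_simp
  refine ⟨a, hne2, ?_, ?_, ?_⟩
  · have : inversion a (RR β a) y = a + (RR β a / ‖y - a‖) ^ 2 • (y - a) := by
      simp [inversion, dist_eq_norm]; abel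
    rw [this, hrho, hya, smul_neg, smul_smul, div_mul_cancel₀ _ hs0, ha, sub_smul, one_smul]
    abel
  · rw [hrho, div_eq_div_iff hs0 hy.ne']
    linear_combination hsm
  · rw [hR, hna]
    have : (s * (s - 1) * ‖z - y‖ ^ 2 - s ^ 2 * ‖z - y‖ ^ 2) * (‖z‖ ^ 2 - ‖y‖ ^ 2) =
      (β + ‖y‖ ^ 2) * ‖z - y‖ ^ 2 := by linear_combination ‖z - y‖ ^ 2 * hsm
    rw [this]; positivity

lemma meas_pol2 {f : Eu (n - 1) → ℝ} (hf : Measurable f) (β : ℝ) :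
    Measurable (fun z : Eu (n - 1) × Eu (n - 1) => pol n α z.1 (RR β z.1) f z.2) := by
  have h0 : Measurable (fun z : Eu (n - 1) × Eu (n - 1) => RR β z.1) :=
    (RR_meas β).comp measurable_fst
  have h1 : Measurable (fun z : Eu (n - 1) × Eu (n - 1) => tw n α z.1 (RR β z.1) f z.2) := by
    unfold tw
    have := hf.comp (meas_inv (c := fun z : Eu (n - 1) × Eu (n - 1) => z.1) measurable_fst h0
      measurable_snd)
    exact ((h0.div (by fun_prop)).pow_const _).mul this
  have h2 : Measurable (fun z : Eu (n - 1) × Eu (n - 1) => sg (SS n z.1 (RR β z.1) z.2)) := by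
    apply meas_sg.comp
    unfold SS
    fun_prop
  have h3 : Measurable (fun z : Eu (n - 1) × Eu (n - 1) => f z.2) := hf.comp measurable_snd
  unfold pol
  exact ((h3.add h1).add (h2.mul (h3.sub h1).abs)).div_const 2

lemma rig1 (H : Par n α) {f : Eu (n - 1) → ℝ} (hf : Measurable f) {β : ℝ} (hβ : 0 < β)
    (hinv : ∀ a : Eu (n - 1), ∀ᵐ y, pol n α a (RR β a) f y = f y) :
    ∀ᵐ y : Eu (n - 1), ∀ᵐ z : Eu (n - 1), 0 < (β - 4) * (‖z‖ ^ 2 - ‖y‖ ^ 2) →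
      ((β + ‖z‖ ^ 2) / (β + ‖y‖ ^ 2)) ^ kap n α * f z ≤ f y := by
  have hm : MeasurableSet {z : Eu (n - 1) × Eu (n - 1) | pol n α z.1 (RR β z.1) f z.2 = f z.2} :=
    measurableSet_eq_fun (meas_pol2 hf β) (hf.comp measurable_snd)
  have h1 := (Measure.ae_ae_comm (μ := (volume : Measure (Eu (n - 1))))
    (ν := (volume : Measure (Eu (n - 1)))) (p := fun a y => pol n α a (RR β a) f y = f y) hm).1
    (Filter.Eventually.of_forall hinv)
  filter_upwards [h1] with y hy
  set A := {a : Eu (n - 1) | ¬ pol n α a (RR β a) f y = f y} with hA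
  have hA0 : volume A = 0 := hy
  have hI : volume ((fun a => inversion a (RR β a) y) '' (A \ {y})) = 0 := by
    apply addHaar_image_eq_zero_of_differentiableOn_of_addHaar_eq_zero
    · apply DifferentiableOn.inversion
      · exact differentiableOn_id
      · intro a _
        apply DifferentiableAt.differentiableWithinAt
        unfold RR
        apply DifferentiableAt.sqrt
        · exact (differentiableAt_const _).add (differentiableAt_id.norm_sq ℝ)
        · positivity
      · exact differentiableOn_const _
      · intro a ha h
        exact ha.2 h.symm
    · exact measure_mono_null Set.sdiff_subset hA0
  filter_upwards [compl_mem_ae_iff.2 hI] with z hz hpos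
  obtain ⟨a, hya, hinv', hrho, hsgn⟩ := geo hβ y z (by rintro h; rw [h] at hpos; simp at hpos)
  have haA : a ∉ A := by
    intro h
    exact hz ⟨a, ⟨h, fun h => hya h.symm⟩, hinv'⟩
  have hpol : pol n α a (RR β a) f y = f y := by simpa [hA] using haA
  have hSS : 0 < SS n a (RR β a) y := by
    unfold SS
    rw [show RR β a ^ 2 - (4 + ‖a‖ ^ 2) = β - 4 by rw [RR_sq hβ]; ring]
    have h1 := mul_pos hpos hsgn
    have : 0 < ((β - 4) * (RR β a ^ 2 - ‖y - a‖ ^ 2)) * (‖z‖ ^ 2 - ‖y‖ ^ 2) ^ 2 := by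
      linarith
    exact pos_of_mul_pos_left this (sq_nonneg _)
  rw [pol_pos hSS] at hpol
  have h2 : tw n α a (RR β a) f y ≤ f y := by rw [← hpol]; exact le_max_right _ _
  have hRp := RR_pos hβ a
  rw [tw, hinv', Real.rpow_mul (by positivity)] at h2
  norm_num only [Real.rpow_two] at h2
  rwa [hrho] at h2

lemma rig_lim {κ Y Z fy fz : ℝ} (hY : 0 ≤ Y) (hZ : 0 ≤ Z) {σ : ℝ}
    (h : ∀ k : ℕ, ((4 + σ / (k + 1) + Z) / (4 + σ / (k + 1) + Y)) ^ κ * fz ≤ fy) :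
    ((4 + Z) / (4 + Y)) ^ κ * fz ≤ fy := by
  have t0 : Filter.Tendsto (fun k : ℕ => σ / ((k : ℝ) + 1)) Filter.atTop (nhds 0) := by
    have := (tendsto_one_div_add_atTop_nhds_zero_nat (𝕜 := ℝ)).const_mul σ
    simpa [div_eq_mul_inv] using this
  refine le_of_tendsto' (f := fun k : ℕ => ((4 + σ / (k + 1) + Z) / (4 + σ / (k + 1) + Y)) ^ κ * fz)
    (x := Filter.atTop) ?_ h
  have c : ContinuousAt (fun t : ℝ => ((4 + t + Z) / (4 + t + Y)) ^ κ * fz) 0 := by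
    have hd : (4 + (0 : ℝ) + Y) ≠ 0 := by linarith
    have : ContinuousAt (fun t : ℝ => (4 + t + Z) / (4 + t + Y)) 0 :=
      ContinuousAt.div (by fun_prop) (by fun_prop) hd
    refine (this.rpow_const (Or.inl ?_)).mul continuousAt_const
    positivity
  have := c.tendsto.comp t0
  simpa [Function.comp_def] using this

lemma rigidity (H : Par n α) {f : Eu (n - 1) → ℝ} (hf : Measurable f) (hf0 : ∀ y, 0 ≤ f y)
    (hinv : ∀ β : ℝ, 0 < β → β ≠ 4 → ∀ a : Eu (n - 1), ∀ᵐ y, pol n α a (RR β a) f y = f y) :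
    ∃ k, 0 ≤ k ∧ ∀ᵐ y, f y = k * hh n α y := by
  have hp : ∀ k : ℕ, 0 < 1 / ((k : ℝ) + 1) := fun k => by positivity
  have hp1 : ∀ k : ℕ, 1 / ((k : ℝ) + 1) ≤ 1 := fun k => by
    rw [div_le_one (by positivity)]; linarith [(Nat.cast_nonneg k : (0 : ℝ) ≤ k)]
  have h1 : ∀ k : ℕ, _ := fun k : ℕ => rig1 H hf (β := 4 + 1 / ((k : ℝ) + 1))
    (by linarith [hp k]) (hinv _ (by linarith [hp k]) (by linarith [hp k]))
  have h2 : ∀ k : ℕ, _ := fun k : ℕ => rig1 H hf (β := 4 + (-1) / ((k : ℝ) + 1))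
    (by rw [neg_div]; linarith [hp1 k])
    (hinv _ (by rw [neg_div]; linarith [hp1 k]) (by rw [neg_div]; linarith [hp k]))
  have h3 : ∀ᵐ y : Eu (n - 1), ∀ᵐ z : Eu (n - 1), ‖z‖ ≠ ‖y‖ → f z / hh n α z ≤ f y / hh n α y := by
    filter_upwards [ae_all_iff.2 h1, ae_all_iff.2 h2] with y hy1 hy2
    filter_upwards [ae_all_iff.2 hy1, ae_all_iff.2 hy2] with z hz1 hz2 hne
    have key : ((4 + ‖z‖ ^ 2) / (4 + ‖y‖ ^ 2)) ^ kap n α * f z ≤ f y := by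
      rcases lt_or_gt_of_ne hne with h | h
      · refine rig_lim (σ := -1) (by positivity) (by positivity) fun k => hz2 k ?_
        have : ‖z‖ ^ 2 < ‖y‖ ^ 2 := pow_lt_pow_left₀ h (norm_nonneg _) two_ne_zero
        have := hp k
        rw [neg_div]
        nlinarith
      · refine rig_lim (σ := 1) (by positivity) (by positivity) fun k => hz1 k ?_
        have : ‖y‖ ^ 2 < ‖z‖ ^ 2 := pow_lt_pow_left₀ h (norm_nonneg _) two_ne_zero
        have := hp k
        nlinarith
    have e : ((4 + ‖z‖ ^ 2) / (4 + ‖y‖ ^ 2)) ^ kap n α = hh n α y / hh n α z := by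
      unfold hh
      rw [← Real.div_rpow (by positivity) (by positivity)]
      congr 1
      field_simp
    rw [e] at key
    rw [div_le_div_iff₀ (hh_pos z) (hh_pos y)]
    have := mul_le_mul_of_nonneg_right key (hh_pos (α := α) z).le
    have hz := (hh_pos (α := α) z).ne'
    have e2 : hh n α y / hh n α z * f z * hh n α z = f z * hh n α y := by field_simp
    linarith
  have hu : Measurable (fun y => f y / hh n α y) := hf.div meas_hh
  have hm : MeasurableSet {z : Eu (n - 1) × Eu (n - 1) |
      ‖z.2‖ ≠ ‖z.1‖ → f z.2 / hh n α z.2 ≤ f z.1 / hh n α z.1} := by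
    have : {z : Eu (n - 1) × Eu (n - 1) |
      ‖z.2‖ ≠ ‖z.1‖ → f z.2 / hh n α z.2 ≤ f z.1 / hh n α z.1} = {z | ‖z.2‖ = ‖z.1‖} ∪
        {z | f z.2 / hh n α z.2 ≤ f z.1 / hh n α z.1} := by
      ext z; simp only [Set.mem_setOf_eq, Set.mem_union]; tauto
    rw [this]
    exact (measurableSet_eq_fun (by fun_prop) (by fun_prop)).union
      (measurableSet_le (hu.comp measurable_snd) (hu.comp measurable_fst))
  have h4 := (Measure.ae_ae_comm (μ := (volume : Measure (Eu (n - 1))))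
    (ν := (volume : Measure (Eu (n - 1))))
    (p := fun y z => ‖z‖ ≠ ‖y‖ → f z / hh n α z ≤ f y / hh n α y) hm).1 h3
  obtain ⟨y, hy1, hy2⟩ := (h3.and h4).exists
  have : Nonempty (Fin (n - 1)) := ⟨⟨0, H.n1pos⟩⟩
  have : Nontrivial (Eu (n - 1)) := inferInstance
  have hsph : ∀ᵐ z : Eu (n - 1), ‖z‖ ≠ ‖y‖ := by
    have := Measure.addHaar_sphere (volume : Measure (Eu (n - 1))) 0 ‖y‖
    filter_upwards [compl_mem_ae_iff.2 this] with z hz h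
    exact hz (by simpa using h)
  refine ⟨f y / hh n α y, div_nonneg (hf0 y) (hh_pos y).le, ?_⟩
  filter_upwards [hy1, hy2, hsph] with z h1 h2 h3
  have := le_antisymm (h1 h3) (h2 h3.symm)
  rw [← this, div_mul_cancel₀ _ (hh_pos z).ne']

end
end HLS

namespace HLS
open EuclideanGeometry Filter Topology

lemma weak_compact {X : Type*} [MeasurableSpace X] [MeasurableSpace.CountablyGenerated X]
    (μ : Measure X) [IsFiniteMeasure μ] {M : ℝ} (hM : 0 ≤ M) (u : ℕ → X → ℝ)
    (hm : ∀ k, Measurable (u k))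
    (h0 : ∀ k x, 0 ≤ u k x) (h1 : ∀ k x, u k x ≤ M) :
    ∃ φ : ℕ → ℕ, StrictMono φ ∧ ∃ v : X → ℝ, Measurable v ∧ (∀ x, 0 ≤ v x) ∧ (∀ x, v x ≤ M) ∧
      ∀ ψ : X → ℝ, Measurable ψ → (∃ C, ∀ x, |ψ x| ≤ C) →
        Tendsto (fun k => ∫ x, u (φ k) x * ψ x ∂μ) atTop (𝓝 (∫ x, v x * ψ x ∂μ)) := by
  have hb : ∀ k x, ‖u k x‖ ≤ M := fun k x => by
    rw [Real.norm_of_nonneg (h0 k x)]; exact h1 k x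
  have hmem : ∀ k, MemLp (u k) 2 μ := fun k =>
    MemLp.of_bound (hm k).aestronglyMeasurable M (Eventually.of_forall (hb k))
  set U : ℕ → Lp ℝ 2 μ := fun k => (hmem k).toLp (u k) with hU
  obtain ⟨B, hB⟩ : ∃ B : ℝ, ∀ k, ‖U k‖ ≤ B := by
    refine ⟨_, fun k => Lp.norm_le_of_ae_bound (C := M) hM ?_⟩
    filter_upwards [(hmem k).coeFn_toLp] with x hx
    rw [hU]; simp only; rw [hx]; exact hb k x
  haveI : Fact ((2 : ℝ≥0∞) ≠ ⊤) := ⟨by norm_num⟩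
  have hsc := WeakDual.isSeqCompact_closedBall ℝ (E := Lp ℝ 2 μ) 0 B
  set Lk : ℕ → WeakDual ℝ (Lp ℝ 2 μ) := fun k =>
    StrongDual.toWeakDual (InnerProductSpace.toDual ℝ (Lp ℝ 2 μ) (U k)) with hLk
  have hmemk : ∀ k, Lk k ∈ (WeakDual.toStrongDual (𝕜 := ℝ) (E := Lp ℝ 2 μ)) ⁻¹' closedBall 0 B := by
    intro k
    rw [Set.mem_preimage, mem_closedBall, dist_zero_right]
    exact (LinearIsometryEquiv.norm_map (InnerProductSpace.toDual ℝ (Lp ℝ 2 μ)) (U k)).trans_le (hB k)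
  obtain ⟨ℓ, -, φ, hφ, hlim⟩ := hsc hmemk
  set v0 : Lp ℝ 2 μ := (InnerProductSpace.toDual ℝ (Lp ℝ 2 μ)).symm (WeakDual.toStrongDual ℓ)
    with hv0
  have hconv : ∀ w : Lp ℝ 2 μ, Tendsto (fun k => inner ℝ (U (φ k)) w) atTop (𝓝 (inner ℝ v0 w)) := by
    intro w
    have := ((WeakDual.eval_continuous w).tendsto ℓ).comp hlim
    have e : (inner ℝ v0 w : ℝ) = ℓ w := by
      rw [hv0, InnerProductSpace.toDual_symm_apply]; rfl
    rw [e]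
    exact this
  have hsm : Measurable (v0 : X → ℝ) := (Lp.stronglyMeasurable v0).measurable
  have hv0i : Integrable (v0 : X → ℝ) μ := (Lp.memLp v0).integrable (by norm_num)
  have hconv2 : ∀ ψ : X → ℝ, Measurable ψ → (∃ C, ∀ x, |ψ x| ≤ C) →
      Tendsto (fun k => ∫ x, u (φ k) x * ψ x ∂μ) atTop (𝓝 (∫ x, v0 x * ψ x ∂μ)) := by
    rintro ψ hψ ⟨C, hC⟩
    have hψm : MemLp ψ 2 μ := MemLp.of_bound hψ.aestronglyMeasurable C (Eventually.of_forall hC)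
    have := hconv (hψm.toLp ψ)
    simp only [L2.inner_def] at this
    convert this using 2
    · apply integral_congr_ae
      rename_i k
      filter_upwards [hψm.coeFn_toLp, (hmem (φ k)).coeFn_toLp] with x hx hx'
      rw [hx, hx']; simp [mul_comm]
    · apply integral_congr_ae
      filter_upwards [hψm.coeFn_toLp] with x hx
      rw [hx]; simp [mul_comm]
  have hset : ∀ s, MeasurableSet s → Tendsto (fun k => ∫ x in s, u (φ k) x ∂μ) atTop
      (𝓝 (∫ x in s, v0 x ∂μ)) := by
    intro s hs
    have := hconv2 (s.indicator 1) (measurable_one.indicator hs)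
      ⟨1, fun x => by by_cases h : x ∈ s <;> simp [h]⟩
    have e : ∀ w : X → ℝ, ∫ x, w x * s.indicator 1 x ∂μ = ∫ x in s, w x ∂μ := by
      intro w
      rw [← integral_indicator hs]
      congr 1; ext x; by_cases h : x ∈ s <;> simp [h]
    simpa only [e] using this
  have hui : ∀ k, Integrable (u k) μ := fun k => (hmem k).integrable (by norm_num)
  have hv_nonneg : 0 ≤ᵐ[μ] v0 := by
    apply ae_nonneg_of_forall_setIntegral_nonneg hv0i
    intro s hs _
    exact ge_of_tendsto' (hset s hs) fun k => integral_nonneg (h0 _)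
  have hv_le : 0 ≤ᵐ[μ] fun x => M - v0 x := by
    apply ae_nonneg_of_forall_setIntegral_nonneg ((integrable_const M).sub hv0i)
    intro s hs _
    show 0 ≤ ∫ x in s, (M - v0 x) ∂μ
    rw [integral_sub (integrable_const M) hv0i.integrableOn]
    refine ge_of_tendsto' ((hset s hs).const_sub (∫ x in s, M ∂μ)) fun k => ?_
    rw [← integral_sub (integrable_const M) (hui _).integrableOn]
    exact integral_nonneg fun x => by simpa using h1 _ x
  refine ⟨φ, hφ, fun x => max 0 (min (v0 x) M), by fun_prop, fun x => le_max_left _ _,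
    fun x => max_le hM (min_le_right _ _), fun ψ hψ hC => ?_⟩
  convert hconv2 ψ hψ hC using 2
  apply integral_congr_ae
  filter_upwards [hv_nonneg, hv_le] with x h1 h2
  have h1' : 0 ≤ v0 x := h1
  have h2' : 0 ≤ M - v0 x := h2
  show max 0 (min (v0 x) M) * ψ x = v0 x * ψ x
  rw [min_eq_left (by linarith), max_eq_right h1']

lemma tangent {a b P : ℝ} (ha : 0 ≤ a) (hb : 0 ≤ b) (hP : 1 < P) :
    b ^ P + P * (a * b ^ (P - 1) - b * b ^ (P - 1)) ≤ a ^ P := by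
  rcases hb.eq_or_lt with rfl | hb
  · rw [Real.zero_rpow (by linarith), Real.zero_rpow (by linarith)]
    simp; positivity
  · have := one_add_mul_self_le_rpow_one_add (s := a / b - 1) (p := P)
      (by have : 0 ≤ a / b := by positivity
          linarith) hP.le
    rw [add_sub_cancel, Real.div_rpow ha hb.le, le_div_iff₀ (by positivity)] at this
    have e : b ^ P = b ^ (P - 1) * b := by rw [← Real.rpow_add_one hb.ne']; ring_nf
    refine le_trans (le_of_eq ?_) this
    rw [e]; field_simp

section
variable {n : ℕ} {α : ℝ}

/-- weighted measure -/
def mu (n : ℕ) (α : ℝ) : Measure (Eu (n - 1)) :=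
  volume.withDensity fun y => ENNReal.ofReal (hh n α y ^ pp n α)

lemma mu_fin (H : Par n α) : IsFiniteMeasure (mu n α) :=
  isFiniteMeasure_withDensity_ofReal (hh_p_int H).2

lemma mu_integral (u : Eu (n - 1) → ℝ) : ∫ y, u y ∂(mu n α) = ∫ y, hh n α y ^ pp n α * u y := by
  unfold mu
  rw [integral_withDensity_eq_integral_toReal_smul₀]
  · congr 1; ext y
    rw [ENNReal.toReal_ofReal (Real.rpow_nonneg (hh_pos y).le _), smul_eq_mul]
  · exact (meas_hh.pow_const _).ennreal_ofReal.aemeasurable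
  · simp

lemma Phi_nonneg (f : Eu (n - 1) → ℝ) (hf : ∀ y, 0 ≤ f y) : 0 ≤ Phi n α f :=
  setIntegral_nonneg (meas_upper n) fun _ hx => Real.rpow_nonneg (Op_nonneg hx hf) _

lemma NN_nonneg {P : ℝ} (f : Eu (n - 1) → ℝ) (hf : ∀ y, 0 ≤ f y) : 0 ≤ NN n α P f :=
  integral_nonneg fun y => mul_nonneg (Real.rpow_nonneg (hf y) _) (Real.rpow_nonneg (hh_pos y).le _)

lemma Phi_le (H : Par n α) {M : ℝ} (hM : 0 ≤ M) {f : Eu (n - 1) → ℝ} (hf : Adm n α M f) :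
    Phi n α f ≤ M ^ qq n α * Phi n α (hh n α) := by
  unfold Phi
  rw [← integral_const_mul]
  exact setIntegral_mono_on (Op_q_int H hM hf) ((Op_hh_int H).const_mul _) (meas_upper n)
    fun x hx => Op_q_le H hM hf hx

lemma NN_mu {P : ℝ} {u : Eu (n - 1) → ℝ} (hu : ∀ y, 0 ≤ u y) :
    NN n α P (fun y => u y * hh n α y) = ∫ y, u y ^ P ∂(mu n α) := by
  rw [mu_integral, NN]
  congr 1; ext y
  have h := hh_pos (α := α) y
  rw [Real.mul_rpow (hu y) h.le, mul_assoc, ← Real.rpow_add h]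
  ring_nf

/-- existence of maximizers -/
lemma exists_max (H : Par n α) {M P lam : ℝ} (hM : 0 ≤ M) (hP : 1 < P) (hlam : 0 ≤ lam) :
    ∃ f, Adm n α M f ∧ ∀ g, Adm n α M g →
      Phi n α g - lam * NN n α P g ^ (qq n α / P) ≤ Phi n α f - lam * NN n α P f ^ (qq n α / P) := by
  have := mu_fin H
  have hq := H.q_gt
  have hqP : 0 < qq n α / P := by apply div_pos <;> linarith
  set G : (Eu (n - 1) → ℝ) → ℝ := fun f => Phi n α f - lam * NN n α P f ^ (qq n α / P) with hG
  set T : Set ℝ := G '' {f | Adm n α M f} with hT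
  have hTne : T.Nonempty := ⟨G (fun _ => 0), _, ⟨measurable_const, fun _ => le_rfl,
    fun y => mul_nonneg hM (hh_pos y).le⟩, rfl⟩
  have hTb : BddAbove T := by
    refine ⟨M ^ qq n α * Phi n α (hh n α), ?_⟩
    rintro _ ⟨f, hf, rfl⟩
    have h1 := Phi_le H hM hf
    have h2 : 0 ≤ lam * NN n α P f ^ (qq n α / P) :=
      mul_nonneg hlam (Real.rpow_nonneg (NN_nonneg f hf.nonneg) _)
    simp only [hG]; linarith
  obtain ⟨t, -, htl, htm⟩ := exists_seq_tendsto_sSup hTne hTb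
  choose F hF hFt using htm
  set u : ℕ → Eu (n - 1) → ℝ := fun k y => F k y / hh n α y with hu
  have hu0 : ∀ k y, 0 ≤ u k y := fun k y => div_nonneg ((hF k).nonneg y) (hh_pos y).le
  have huF : ∀ k, F k = fun y => u k y * hh n α y := fun k => by
    ext y; simp only [hu]; rw [div_mul_cancel₀ _ (hh_pos y).ne']
  have hu1 : ∀ k y, u k y ≤ M := fun k y => by
    simp only [hu]; rw [div_le_iff₀ (hh_pos y)]; exact (hF k).le y
  have hum : ∀ k, Measurable (u k) := fun k => (hF k).meas.div meas_hh
  obtain ⟨φ, hφ, v, hvm, hv0, hv1, hconv⟩ := weak_compact (mu n α) hM u hum hu0 hu1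
  set f : Eu (n - 1) → ℝ := fun y => v y * hh n α y with hf
  have hfA : Adm n α M f := ⟨hvm.mul meas_hh, fun y => mul_nonneg (hv0 y) (hh_pos y).le,
    fun y => mul_le_mul_of_nonneg_right (hv1 y) (hh_pos y).le⟩
  -- pointwise convergence of the extension
  have hOp : ∀ x ∈ upperHalf n, Tendsto (fun k => Op n α (F (φ k)) x) atTop (𝓝 (Op n α f x)) := by
    intro x hx
    obtain ⟨C, hC, hK⟩ := KK_bound H hx
    have e : ∀ w : Eu (n - 1) → ℝ, Op n α (fun y => w y * hh n α y) x =
        ∫ y, w y * (KK n α x y / hh n α y ^ (pp n α - 1)) ∂(mu n α) := by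
      intro w
      rw [mu_integral, Op]
      congr 1; ext y
      rw [← hp_split y H]
      have := (Real.rpow_pos_of_pos (hh_pos (α := α) y) (pp n α - 1)).ne'
      field_simp
    have := hconv (fun y => KK n α x y / hh n α y ^ (pp n α - 1))
      ((meas_KK x).div (meas_hh.pow_const _)) ⟨C, fun y => by
        have h1 := Real.rpow_pos_of_pos (hh_pos (α := α) y) (pp n α - 1)
        rw [abs_of_nonneg (div_nonneg (KK_nonneg hx y) h1.le), div_le_iff₀ h1]
        exact hK y⟩
    rw [hf, e]
    simp only [huF, e]
    exact this
  have hPhi : Tendsto (fun k => Phi n α (F (φ k))) atTop (𝓝 (Phi n α f)) := by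
    unfold Phi
    refine tendsto_integral_of_dominated_convergence
      (fun x => M ^ qq n α * Op n α (hh n α) x ^ qq n α)
      (fun k => ((meas_Op (hF _).meas).pow_const _).aestronglyMeasurable)
      ((Op_hh_int H).const_mul _) (fun k => ?_) ?_
    · refine (ae_restrict_iff' (meas_upper n)).2 (Eventually.of_forall fun x hx => ?_)
      rw [Real.norm_of_nonneg (Real.rpow_nonneg (Op_nonneg hx (hF _).nonneg) _)]
      exact Op_q_le H hM (hF _) hx
    · refine (ae_restrict_iff' (meas_upper n)).2 (Eventually.of_forall fun x hx => ?_)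
      exact (hOp x hx).rpow_const (Or.inr (by linarith))
  -- lower semicontinuity
  set ψ : Eu (n - 1) → ℝ := fun y => v y ^ (P - 1) with hψ
  have hψm : Measurable ψ := hvm.pow_const _
  have hψb : ∀ y, |ψ y| ≤ M ^ (P - 1) := fun y => by
    rw [abs_of_nonneg (Real.rpow_nonneg (hv0 y) _)]
    exact Real.rpow_le_rpow (hv0 y) (hv1 y) (by linarith)
  have hbi : ∀ w : Eu (n - 1) → ℝ, Measurable w → (∀ y, 0 ≤ w y) → (∀ y, w y ≤ M) →
      Integrable (fun y => w y * ψ y) (mu n α) ∧ Integrable (fun y => w y ^ P) (mu n α) := by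
    intro w hw h0 h1
    constructor
    · refine Integrable.of_bound (hw.mul hψm).aestronglyMeasurable (M * M ^ (P - 1))
        (Eventually.of_forall fun y => ?_)
      rw [Real.norm_eq_abs, abs_mul, abs_of_nonneg (h0 y)]
      exact mul_le_mul (h1 y) (hψb y) (abs_nonneg _) hM
    · refine Integrable.of_bound (hw.pow_const _).aestronglyMeasurable (M ^ P)
        (Eventually.of_forall fun y => ?_)
      rw [Real.norm_of_nonneg (Real.rpow_nonneg (h0 y) _)]
      exact Real.rpow_le_rpow (h0 y) (h1 y) (by linarith)
  set E : ℕ → ℝ := fun k => ∫ y, v y ^ P ∂(mu n α) +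
    P * (∫ y, u (φ k) y * ψ y ∂(mu n α) - ∫ y, v y * ψ y ∂(mu n α)) with hE
  have hEl : Tendsto E atTop (𝓝 (∫ y, v y ^ P ∂(mu n α))) := by
    have := (((hconv ψ hψm ⟨_, hψb⟩).sub_const (∫ y, v y * ψ y ∂(mu n α))).const_mul P).const_add
      (∫ y, v y ^ P ∂(mu n α))
    simpa using this
  have hEle : ∀ k, E k ≤ NN n α P (F (φ k)) := by
    intro k
    obtain ⟨iv1, iv2⟩ := hbi v hvm hv0 hv1
    obtain ⟨iu1, iu2⟩ := hbi (u (φ k)) (hum _) (hu0 _) (hu1 _)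
    rw [huF, NN_mu (hu0 _)]
    simp only [hE]
    have i3 : Integrable (fun y => P * (u (φ k) y * ψ y - v y * ψ y)) (mu n α) :=
      (iu1.sub iv1).const_mul P
    rw [← integral_sub iu1 iv1, ← integral_const_mul, ← integral_add iv2 i3]
    refine integral_mono (iv2.add i3) iu2 fun y => ?_
    exact tangent (hu0 _ y) (hv0 y) hP
  have hS : sSup T ≤ G f := by
    have hlim : Tendsto (fun k => Phi n α (F (φ k)) - lam * (max (E k) 0) ^ (qq n α / P)) atTop
        (𝓝 (G f)) := by
      simp only [hG]
      refine hPhi.sub (Tendsto.const_mul _ ?_)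
      rw [hf, NN_mu hv0]
      have h0 : 0 ≤ ∫ y, v y ^ P ∂(mu n α) := integral_nonneg fun y => Real.rpow_nonneg (hv0 y) _
      have := (hEl.max (tendsto_const_nhds (x := (0 : ℝ)))).rpow_const (p := qq n α / P)
        (Or.inr hqP.le)
      rwa [max_eq_left h0] at this
    refine le_of_tendsto_of_tendsto' (htl.comp hφ.tendsto_atTop) hlim fun k => ?_
    simp only [Function.comp]
    rw [← hFt]
    simp only [hG]
    have h1 : max (E k) 0 ≤ NN n α P (F (φ k)) := max_le (hEle k) (NN_nonneg _ (hF _).nonneg)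
    have h2 := Real.rpow_le_rpow (le_max_right _ _) h1 hqP.le
    have := mul_le_mul_of_nonneg_left h2 hlam
    linarith
  exact ⟨f, hfA, fun g hg => (le_csSup hTb ⟨g, hg, rfl⟩).trans hS⟩

/-- the total mass -/
def bb (n : ℕ) (α : ℝ) : ℝ := ∫ y, hh n α y ^ pp n α

lemma bb_pos (H : Par n α) : 0 < bb n α := by
  unfold bb
  rw [integral_pos_iff_support_of_nonneg (fun y => Real.rpow_nonneg (hh_pos y).le _) (hh_p_int H)]
  have : Function.support (fun y => hh n α y ^ pp n α) = Set.univ := by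
    ext y; simp [(Real.rpow_pos_of_pos (hh_pos (α := α) y) (pp n α)).ne']
  rw [this]; exact isOpen_univ.measure_pos volume Set.univ_nonempty

lemma NN_hh {P : ℝ} {k : ℝ} (hk : 0 ≤ k) : NN n α P (fun y => k * hh n α y) = k ^ P * bb n α := by
  rw [NN_mu (u := fun _ => k) (fun _ => hk), mu_integral, integral_mul_const, bb, mul_comm]

lemma Phi_hh (k : ℝ) (hk : 0 ≤ k) :
    Phi n α (fun y => k * hh n α y) = k ^ qq n α * Phi n α (hh n α) := by
  unfold Phi
  rw [← integral_const_mul]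
  refine setIntegral_congr_fun (meas_upper n) fun x hx => ?_
  have : Op n α (fun y => k * hh n α y) x = k * Op n α (hh n α) x := by
    unfold Op; rw [← integral_const_mul]; congr 1; ext y; ring
  simp only [this]
  rw [Real.mul_rpow hk (Op_nonneg hx fun y => (hh_pos y).le)]

lemma Phi_congr {f g : Eu (n - 1) → ℝ} (h : ∀ᵐ y, f y = g y) : Phi n α f = Phi n α g := by
  have : Op n α f = Op n α g := by
    ext x
    apply integral_congr_ae
    filter_upwards [h] with y hy
    rw [hy]
  unfold Phi; rw [this]

lemma NN_congr {P : ℝ} {f g : Eu (n - 1) → ℝ} (h : ∀ᵐ y, f y = g y) : NN n α P f = NN n α P g := by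
  apply integral_congr_ae
  filter_upwards [h] with y hy
  rw [hy]

lemma sharp_P (H : Par n α) {M P lam : ℝ} (hM : 0 ≤ M) (hP : pp n α < P) (hlam : 0 < lam)
    (hl : Phi n α (hh n α) ≤ lam * bb n α ^ (qq n α / P)) {g : Eu (n - 1) → ℝ} (hg : Adm n α M g) :
    Phi n α g ≤ lam * NN n α P g ^ (qq n α / P) := by
  have hp1 := H.p_gt
  have hq := H.q_gt
  have hqP : 0 < qq n α / P := by apply div_pos <;> linarith
  obtain ⟨f, hf, hmax⟩ := exists_max H hM (by linarith : 1 < P) hlam.le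
  have hinv : ∀ β : ℝ, 0 < β → β ≠ 4 → ∀ a : Eu (n - 1), ∀ᵐ y, pol n α a (RR β a) f y = f y := by
    intro β hβ hβ4 a
    have hR := RR_pos hβ a
    have hc : RR β a ^ 2 - (4 + ‖a‖ ^ 2) ≠ 0 := by
      rw [RR_sq hβ]; intro h; apply hβ4; linarith
    obtain ⟨h1, h2⟩ := NN_pol H hM hP a hR hc hf
    apply h2
    have hA := pol_adm H hR hM hc hf
    have h3 := hmax _ hA
    have h4 := Phi_pol H a hR hc hM hf
    refine le_antisymm h1 ?_
    by_contra hlt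
    push Not at hlt
    have := Real.rpow_lt_rpow (NN_nonneg _ hA.nonneg) hlt hqP
    have := mul_lt_mul_of_pos_left this hlam
    linarith
  obtain ⟨k, hk, hfk⟩ := rigidity H hf.meas hf.nonneg hinv
  have h1 := hmax g hg
  rw [Phi_congr hfk, NN_congr hfk, Phi_hh k hk, NN_hh hk,
    Real.mul_rpow (by positivity) (bb_pos H).le, ← Real.rpow_mul hk,
    mul_div_cancel₀ _ (by linarith : P ≠ 0)] at h1
  have := mul_le_mul_of_nonneg_left hl (Real.rpow_nonneg hk (qq n α))
  linarith

lemma sharp_P' (H : Par n α) {M P : ℝ} (hM : 0 ≤ M) (hP : pp n α < P)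
    {g : Eu (n - 1) → ℝ} (hg : Adm n α M g) :
    Phi n α g * bb n α ^ (qq n α / P) ≤ Phi n α (hh n α) * NN n α P g ^ (qq n α / P) := by
  have hb := Real.rpow_pos_of_pos (bb_pos H) (qq n α / P)
  set N := NN n α P g ^ (qq n α / P) with hN
  have hN0 : 0 ≤ N := Real.rpow_nonneg (NN_nonneg _ hg.nonneg) _
  have h0 := Phi_nonneg (α := α) (hh n α) fun y => (hh_pos y).le
  apply _root_.le_of_forall_pos_le_add
  intro ε hε
  set δ := ε / (N * bb n α ^ (qq n α / P) + 1) with hδ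
  have hd : 0 < N * bb n α ^ (qq n α / P) + 1 := by positivity
  have hδ0 : 0 < δ := by positivity
  have h := sharp_P H hM hP (lam := Phi n α (hh n α) / bb n α ^ (qq n α / P) + δ) (by positivity)
    (by rw [add_mul, div_mul_cancel₀ _ hb.ne']; linarith [mul_pos hδ0 hb]) hg
  have h2 := mul_le_mul_of_nonneg_right h hb.le
  rw [← hN] at h2
  have e : (Phi n α (hh n α) / bb n α ^ (qq n α / P) + δ) * N * bb n α ^ (qq n α / P) =
      Phi n α (hh n α) * N + δ * (N * bb n α ^ (qq n α / P)) := by field_simp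
  have h3 : δ * (N * bb n α ^ (qq n α / P)) ≤ ε := by
    have : δ * (N * bb n α ^ (qq n α / P) + 1) = ε := div_mul_cancel₀ _ hd.ne'
    linarith
  linarith

lemma sharp_adm (H : Par n α) {M : ℝ} (hM : 0 ≤ M) {g : Eu (n - 1) → ℝ} (hg : Adm n α M g) :
    Phi n α g * bb n α ^ (qq n α / pp n α) ≤
      Phi n α (hh n α) * (∫ y, g y ^ pp n α) ^ (qq n α / pp n α) := by
  have := mu_fin H
  have hp1 := H.p_gt
  have hq := H.q_gt
  set Pk : ℕ → ℝ := fun k => pp n α + 1 / ((k : ℝ) + 1) with hPk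
  have hPl : Tendsto Pk atTop (𝓝 (pp n α)) := by
    have := (tendsto_one_div_add_atTop_nhds_zero_nat (𝕜 := ℝ)).const_add (pp n α)
    simpa [hPk] using this
  have hP1 : ∀ k, pp n α < Pk k := fun k => by
    have : 0 < 1 / ((k : ℝ) + 1) := by positivity
    simp only [hPk]; linarith
  have hP2 : ∀ k, Pk k ≤ pp n α + 1 := fun k => by
    have : 1 / ((k : ℝ) + 1) ≤ 1 := by
      rw [div_le_one (by positivity)]; linarith [(Nat.cast_nonneg k : (0 : ℝ) ≤ k)]
    simp only [hPk]; linarith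
  have hql : Tendsto (fun k => qq n α / Pk k) atTop (𝓝 (qq n α / pp n α)) :=
    tendsto_const_nhds.div hPl (by linarith : (0:ℝ) < pp n α).ne'
  set u : Eu (n - 1) → ℝ := fun y => g y / hh n α y with hu
  have hu0 : ∀ y, 0 ≤ u y := fun y => div_nonneg (hg.nonneg y) (hh_pos y).le
  have huF : g = fun y => u y * hh n α y := by
    ext y; simp only [hu]; rw [div_mul_cancel₀ _ (hh_pos y).ne']
  have hu1 : ∀ y, u y ≤ M := fun y => by
    simp only [hu]; rw [div_le_iff₀ (hh_pos y)]; exact hg.le y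
  have hum : Measurable u := hg.meas.div meas_hh
  have e0 : NN n α (pp n α) g = ∫ y, g y ^ pp n α := by simp [NN]
  have hNl : Tendsto (fun k => NN n α (Pk k) g) atTop (𝓝 (∫ y, g y ^ pp n α)) := by
    rw [← e0, huF]
    simp only [NN_mu hu0]
    refine tendsto_integral_of_dominated_convergence (fun _ => (max M 1) ^ (pp n α + 1))
      (fun k => (hum.pow_const _).aestronglyMeasurable) (integrable_const _) (fun k => ?_) ?_
    · refine Eventually.of_forall fun y => ?_
      rw [Real.norm_of_nonneg (Real.rpow_nonneg (hu0 y) _)]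
      calc u y ^ Pk k ≤ (max M 1) ^ Pk k := Real.rpow_le_rpow (hu0 y)
            ((hu1 y).trans (le_max_left _ _)) (by linarith [hP1 k])
        _ ≤ _ := Real.rpow_le_rpow_of_exponent_le (le_max_right _ _) (hP2 k)
    · refine Eventually.of_forall fun y => ?_
      exact ((Real.continuousAt_const_rpow' (a := u y) (b := pp n α) (by linarith)).tendsto.comp hPl)
  have hI0 : 0 ≤ ∫ y, g y ^ pp n α := integral_nonneg fun y => Real.rpow_nonneg (hg.nonneg y) _
  refine le_of_tendsto_of_tendsto' (f := fun k => Phi n α g * bb n α ^ (qq n α / Pk k))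
    (g := fun k => Phi n α (hh n α) * NN n α (Pk k) g ^ (qq n α / Pk k)) (b := atTop) ?_ ?_
    fun k => sharp_P' H hM (hP1 k) hg
  · refine Tendsto.const_mul _ ?_
    exact ((tendsto_const_nhds (x := bb n α)).rpow hql (Or.inl (bb_pos H).ne'))
  · refine Tendsto.const_mul _ ?_
    exact hNl.rpow hql (Or.inr (div_pos (by linarith) (by linarith)))

end
end HLS

namespace HLS
open EuclideanGeometry Filter Topology
open scoped Pointwise

section
variable {n : ℕ} {α : ℝ}

lemma inner_en (hn : 0 < n) (x : Eu n) : inner ℝ x (en n) = lastCoord n x := by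
  rw [PiLp.inner_apply, lastCoord, dif_pos hn, Finset.sum_eq_single ⟨n - 1, Nat.sub_lt hn Nat.one_pos⟩]
  · simp [en]
  · intro i _ hi
    have : (i : ℕ) ≠ n - 1 := fun h => hi (Fin.ext h)
    simp [en, this]
  · simp

lemma norm_en (hn : 0 < n) : ‖en n‖ = 1 := by
  have := norm_sq_split hn (en n)
  rw [pr_en, last_en hn] at this
  have h0 := norm_nonneg (en n)
  simp at this
  rcases this with h | h <;> linarith

lemma sub_xo (x : Eu n) : x - xo n = x + (2 : ℝ) • en n := by
  rw [xo_eq]; module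

lemma sub_zo (x : Eu n) : x - zo n = x + en n := by
  rw [zo_eq]; module

/-- position of the inverted point in the ball -/
lemma ball_formula (hn : 0 < n) {x : Eu n} (hx : x ≠ xo n) :
    1 - ‖inversion (xo n) 2 x - zo n‖ ^ 2 = 8 * lastCoord n x / ‖x - xo n‖ ^ 2 := by
  have hw : 0 < ‖x - xo n‖ := norm_pos_iff.2 (sub_ne_zero.2 hx)
  have e : inversion (xo n) 2 x - zo n = (4 / ‖x - xo n‖ ^ 2) • (x - xo n) - en n := by
    rw [inversion, sub_zo, dist_eq_norm, div_pow, vsub_eq_sub, vadd_eq_add, xo_eq]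
    norm_num
    module
  rw [e, norm_sub_sq_real, norm_smul, real_inner_smul_left, inner_en hn, norm_en hn, last_sub,
    xo_eq, last_smul, last_en hn, ← xo_eq, Real.norm_of_nonneg (by positivity)]
  field_simp
  ring

lemma inversion_ball (hn : 0 < n) {x : Eu n} (hx : x ≠ xo n) :
    inversion (xo n) 2 x ∈ ball (zo n) 1 ↔ x ∈ upperHalf n := by
  have hw : 0 < ‖x - xo n‖ := norm_pos_iff.2 (sub_ne_zero.2 hx)
  have h := ball_formula hn hx
  rw [mem_ball, dist_eq_norm, ← sq_lt_one_iff₀ (norm_nonneg _), ← sub_pos, h]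
  show _ ↔ 0 < lastCoord n x
  constructor
  · intro h
    by_contra h'
    have : 8 * lastCoord n x / ‖x - xo n‖ ^ 2 ≤ 0 :=
      div_nonpos_of_nonpos_of_nonneg (by linarith) (by positivity)
    linarith
  · intro h; positivity

lemma emb_ne_xo (hn : 0 < n) (y : Eu (n - 1)) : emb n y ≠ xo n := by
  intro h
  have := congrArg (lastCoord n) h
  rw [last_emb, xo_eq, last_smul, last_en hn] at this
  norm_num at this

/-- the stereographic map onto the unit sphere -/
def th (n : ℕ) (y : Eu (n - 1)) : Eu n := inversion (xo n) 2 (emb n y) - zo n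

lemma norm_th (hn : 0 < n) (y : Eu (n - 1)) : ‖th n y‖ = 1 := by
  have := ball_formula hn (emb_ne_xo hn y)
  rw [last_emb, mul_zero, zero_div] at this
  have h0 := norm_nonneg (th n y)
  have h1 : ‖th n y‖ ^ 2 = 1 := by unfold th; linarith
  nlinarith

lemma th_inj {y z : Eu (n - 1)} (h : th n y = th n z) : y = z := by
  unfold th at h
  have h1 := sub_left_injective h
  have h2 := inversion_injective (xo n) (two_ne_zero : (2 : ℝ) ≠ 0) h1
  rw [← pr_emb n y, ← pr_emb n z, h2]

lemma th_surj (hn : 0 < n) {u : Eu n} (hu : ‖u‖ = 1) (hne : u ≠ -en n) : ∃ y, th n y = u := by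
  set x := inversion (xo n) 2 (zo n + u) with hx
  have hxx : inversion (xo n) 2 x = zo n + u := inversion_inversion _ two_ne_zero _
  have h1 : zo n + u ≠ xo n := by
    intro h
    apply hne
    rw [zo_eq, xo_eq] at h
    have : u = (-en n + u) + en n := by module
    rw [this, h]; module
  have hx0 : x ≠ xo n := by
    intro h; rw [h] at hxx; apply h1; rw [← hxx]; simp
  have h2 := ball_formula hn hx0
  have hw : 0 < ‖x - xo n‖ := norm_pos_iff.2 (sub_ne_zero.2 hx0)
  rw [hxx, add_sub_cancel_left, hu] at h2
  have h3 : lastCoord n x = 0 := by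
    have h4 : 0 = 8 * lastCoord n x / ‖x - xo n‖ ^ 2 := by rw [← h2]; norm_num
    rw [_root_.eq_div_iff (by positivity)] at h4
    linarith
  refine ⟨pr n x, ?_⟩
  have h5 : emb n (pr n x) = x := by
    conv_rhs => rw [decomp hn x, h3]
    simp
  rw [th, h5, hxx]; abel

lemma meas_th : Measurable (th n) := by
  unfold th
  exact (meas_inv measurable_const measurable_const (cont_emb n).measurable).sub measurable_const

/-- horizontal projection as a continuous linear map -/
def QQ (n : ℕ) : Eu n →L[ℝ] Eu n :=
  ⟨⟨⟨fun x => emb n (pr n x), fun x y => by rw [pr_add, emb_add]⟩,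
    fun c x => by
      show emb n (pr n (c • x)) = c • emb n (pr n x)
      rw [pr_smul, emb_smul]⟩, (cont_emb n).comp (cont_pr n)⟩

/-- last coordinate as a continuous linear map -/
def LL (n : ℕ) : Eu n →L[ℝ] ℝ :=
  ⟨⟨⟨lastCoord n, last_add n⟩, fun c x => by
    show lastCoord n (c • x) = c * lastCoord n x
    rw [last_smul]⟩, cont_last n⟩

@[simp] lemma QQ_apply (x : Eu n) : QQ n x = emb n (pr n x) := rfl
@[simp] lemma LL_apply (x : Eu n) : LL n x = lastCoord n x := rfl

/-- diagonal map -/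
def DD (n : ℕ) (c : ℝ) : Eu n →L[ℝ] Eu n := c • QQ n - (LL n).smulRight (en n)

lemma det_DD (hn : 0 < n) (c : ℝ) : |(DD n c).det| = |c| ^ (n - 1) := by
  obtain ⟨k, rfl⟩ : ∃ k, n = k + 1 := ⟨n - 1, by omega⟩
  set b := (EuclideanSpace.basisFun (Fin (k + 1)) ℝ).toBasis
  set d : Fin (k + 1) → ℝ := fun i => if (i : ℕ) < k then c else -1 with hd
  have e : ((DD (k + 1) c : Eu (k + 1) →L[ℝ] Eu (k + 1)) : Eu (k + 1) →ₗ[ℝ] Eu (k + 1)) =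
      Matrix.toLin b b (Matrix.diagonal d) := by
    apply b.ext
    intro i
    rw [Matrix.toLin_self]
    ext j
    simp only [b, DD, Matrix.diagonal_apply, hd]
    simp [emb, pr, en, lastCoord, EuclideanSpace.basisFun_apply]
    have hi := i.2
    have hj := j.2
    by_cases h1 : (i : ℕ) < k
    · have h2 : (⟨k, Nat.lt_succ_self k⟩ : Fin (k + 1)) ≠ i := by
        intro h; rw [← h] at h1; simp at h1
      rw [if_neg h2, if_pos h1]
      by_cases h3 : j = i
      · subst h3; simp [h1]
      · simp [h3]
    · have h2 : (⟨k, Nat.lt_succ_self k⟩ : Fin (k + 1)) = i := by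
        ext; simp; omega
      rw [if_pos h2, if_neg h1]
      by_cases h3 : j = i
      · subst h3; subst h2; simp
      · have h4 : (j : ℕ) ≠ k := fun h => h3 (by rw [← h2]; exact Fin.ext h)
        simp [h3, h4]
  rw [ContinuousLinearMap.det, e, LinearMap.det_toLin, Matrix.det_diagonal, Fin.prod_univ_castSucc]
  simp [hd, abs_pow]

/-- polar stereographic parametrization -/
def Ps (n : ℕ) (x : Eu n) : Eu n := lastCoord n x • th n (pr n x)

/-- conformal factor -/
def la (n : ℕ) (y : Eu (n - 1)) : ℝ := 4 / (4 + ‖y‖ ^ 2)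

lemma la_pos (y : Eu (n - 1)) : 0 < la n y := by unfold la; positivity

lemma refl_th (H : Par n α) (y : Eu (n - 1)) :
    (ℝ ∙ (emb n y - xo n))ᗮ.reflection (en n) = - th n y := by
  have hn := H.npos
  have hw : 0 < ‖emb n y - xo n‖ := norm_pos_iff.2 (sub_ne_zero.2 (emb_ne_xo hn y))
  rw [Submodule.reflection_orthogonal_apply, Submodule.reflection_singleton_apply, inner_en hn,
    last_sub, last_emb, xo_eq, last_smul, last_en hn, ← xo_eq, th, inversion, sub_zo, dist_eq_norm,
    div_pow, vsub_eq_sub, vadd_eq_add]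
  rw [show ((‖emb n y - xo n‖ : ℝ) : ℝ) = ‖emb n y - xo n‖ from rfl]
  set r := ‖emb n y - xo n‖
  rw [xo_eq]
  norm_num
  match_scalars <;> field_simp <;> ring

lemma deriv_Ps (H : Par n α) (x : Eu n) :
    HasFDerivAt (Ps n) (((ℝ ∙ (emb n (pr n x) - xo n))ᗮ.reflection : Eu n →L[ℝ] Eu n).comp
      (DD n (lastCoord n x * la n (pr n x)))) x := by
  have hn := H.npos
  have h0 : HasFDerivAt (inversion (xo n) 2) _ (QQ n x) :=
    hasFDerivAt_inversion (R := 2) (emb_ne_xo hn (pr n x))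
  have h1 := (h0.comp x (QQ n).hasFDerivAt).sub_const (zo n)
  have h2 := (LL n).hasFDerivAt (x := x) |>.smul h1
  refine h2.congr_fderiv ?_
  ext1 v
  have hl : (2 / dist (emb n (pr n x)) (xo n)) ^ 2 = la n (pr n x) := by
    rw [dist_eq_norm, div_pow, w_eq H, la]; norm_num
  simp only [DD]
  simp [refl_th H, mul_smul, hl]
  rfl

lemma det_Ps (H : Par n α) (x : Eu n) :
    |(((ℝ ∙ (emb n (pr n x) - xo n))ᗮ.reflection : Eu n →L[ℝ] Eu n).comp
      (DD n (lastCoord n x * la n (pr n x)))).det| = |lastCoord n x * la n (pr n x)| ^ (n - 1) := by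
  rw [← det_DD H.npos]
  have h := abs_det_inv 1 (ℝ ∙ (emb n (pr n x) - xo n))ᗮ
  simp only [one_pow, one_smul] at h
  rw [ContinuousLinearMap.det, ContinuousLinearMap.toLinearMap_comp, LinearMap.det_comp, abs_mul]
  rw [ContinuousLinearMap.det] at h
  rw [h, one_mul]

/-- Splitting of Lebesgue measure. -/
lemma mp_split (hn : 0 < n) : MeasurePreserving (fun x : Eu n => (lastCoord n x, pr n x)) volume
    ((volume : Measure ℝ).prod volume) := by
  obtain ⟨k, rfl⟩ : ∃ k, n = k + 1 := ⟨n - 1, by omega⟩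
  have h1 := EuclideanSpace.volume_preserving_symm_measurableEquiv_toLp (Fin (k + 1))
  have h2 := volume_preserving_piFinSuccAbove (fun _ : Fin (k + 1) => ℝ) (Fin.last k)
  have h3 := (EuclideanSpace.volume_preserving_symm_measurableEquiv_toLp (Fin k)).symm
  have h4 := (MeasurePreserving.id (volume : Measure ℝ)).prod h3
  have := h4.comp (h2.comp h1)
  show MeasurePreserving (fun x : Eu (k + 1) => (lastCoord (k + 1) x,
    (pr (k + 1) x : EuclideanSpace ℝ (Fin k)))) volume (volume.prod volume)
  have e : (fun x : Eu (k + 1) => (lastCoord (k + 1) x,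
    (pr (k + 1) x : EuclideanSpace ℝ (Fin k)))) = (Prod.map id ⇑(MeasurableEquiv.toLp 2 (Fin k → ℝ)).symm.symm ∘
      ⇑(MeasurableEquiv.piFinSuccAbove (fun x => ℝ) (Fin.last k)) ∘
        ⇑(MeasurableEquiv.toLp 2 (Fin (k + 1) → ℝ)).symm) := by
    funext x
    refine Prod.ext rfl ?_
    show (WithLp.toLp 2 (fun i : Fin k => x ⟨i, _⟩) : EuclideanSpace ℝ (Fin k)) =
      WithLp.toLp 2 (fun i : Fin k => x ((Fin.last k).succAbove i))
    congr 1
    funext i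
    rw [Fin.succAbove_last]
    rfl
  rw [e]
  exact this

lemma lint_split (hn : 0 < n) {G : ℝ → Eu (n - 1) → ℝ≥0∞} (hG : Measurable (Function.uncurry G)) :
    ∫⁻ x : Eu n, G (lastCoord n x) (pr n x) = ∫⁻ y, ∫⁻ t, G t y := by
  have := (mp_split hn).lintegral_comp (f := Function.uncurry G) hG
  rw [lintegral_prod_symm' _ hG] at this
  exact this

/-- the stereographic map into the sphere -/
def thS (n : ℕ) (hn : 0 < n) (y : Eu (n - 1)) : sphere (0 : Eu n) 1 :=
  ⟨th n y, by rw [mem_sphere_zero_iff_norm]; exact norm_th hn y⟩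

lemma meas_thS (hn : 0 < n) : Measurable (thS n hn) := meas_th.subtype_mk

lemma ray_null (hn : 2 ≤ n) : volume {x : Eu n | ∃ r : ℝ, x = r • en n} = 0 := by
  have h := Measure.addHaar_submodule (volume : Measure (Eu n)) (ℝ ∙ en n) (by
    intro h
    have h1 := finrank_span_singleton (K := ℝ) (v := en n) (by
      intro h0; have := norm_en (n := n) (by omega); rw [h0, norm_zero] at this; norm_num at this)
    rw [h] at h1
    simp at h1
    omega)
  refine measure_mono_null ?_ h
  rintro x ⟨r, rfl⟩
  exact Submodule.mem_span_singleton.2 ⟨r, rfl⟩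

lemma Ps_inj (hn : 0 < n) : Set.InjOn (Ps n) {x | 0 < lastCoord n x} := by
  intro x hx z hz h
  have hx' : 0 < lastCoord n x := hx
  have hz' : 0 < lastCoord n z := hz
  unfold Ps at h
  have h1 := congrArg norm h
  rw [norm_smul, norm_smul, norm_th hn, norm_th hn, Real.norm_of_nonneg hx'.le,
    Real.norm_of_nonneg hz'.le, mul_one, mul_one] at h1
  rw [h1] at h
  have h2 := th_inj (smul_right_injective _ hz'.ne' h)
  rw [decomp hn x, decomp hn z, h1, h2]

lemma toSphere_eq (H : Par n α) : (volume : Measure (Eu n)).toSphere =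
    Measure.map (thS n H.npos)
      (volume.withDensity fun y => ENNReal.ofReal (la n y ^ (n - 1))) := by
  have hn := H.npos
  have hn3 := H.hn
  have mla : Measurable (la n) := by unfold la; fun_prop
  ext s hs
  rw [Measure.map_apply (meas_thS hn) hs, withDensity_apply _ (meas_thS hn hs),
    Measure.toSphere_apply' _ hs]
  set T := thS n hn ⁻¹' s with hT
  have hTm : MeasurableSet T := meas_thS hn hs
  set S : Set (Eu n) := {x | (0 < lastCoord n x ∧ lastCoord n x < 1) ∧ pr n x ∈ T} with hS
  have hSm : MeasurableSet S :=
    ((measurableSet_lt measurable_const (cont_last n).measurable).inter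
      (measurableSet_lt (cont_last n).measurable measurable_const)).inter
      ((cont_pr n).measurable hTm)
  have hae : volume (Set.Ioo (0 : ℝ) 1 • ((↑) '' s : Set (Eu n))) = volume (Ps n '' S) := by
    apply le_antisymm
    · have hsub : Set.Ioo (0 : ℝ) 1 • ((↑) '' s : Set (Eu n)) ⊆
          Ps n '' S ∪ {x : Eu n | ∃ r : ℝ, x = r • en n} := by
        rintro _ ⟨r, hr, _, ⟨u, hu, rfl⟩, rfl⟩
        have hu1 : ‖(u : Eu n)‖ = 1 := mem_sphere_zero_iff_norm.1 u.2
        by_cases hne : (u : Eu n) = -en n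
        · right; exact ⟨-r, by simp [hne]⟩
        · left
          obtain ⟨y, hy⟩ := th_surj hn hu1 hne
          have h1 : lastCoord n (emb n y + r • en n) = r := by
            rw [last_add, last_emb, last_smul, last_en hn]; ring
          have h2 : pr n (emb n y + r • en n) = y := by
            rw [pr_add, pr_emb, pr_smul, pr_en]; simp
          refine ⟨emb n y + r • en n, ⟨?_, ?_⟩, ?_⟩
          · rw [h1]; exact hr
          · rw [h2, hT, Set.mem_preimage]
            have : thS n hn y = u := Subtype.ext hy
            rwa [this]
          · rw [Ps, h1, h2, hy]
      refine (measure_mono hsub).trans ((measure_union_le _ _).trans ?_)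
      rw [ray_null (by omega), add_zero]
    · apply measure_mono
      rintro _ ⟨x, ⟨hx1, hx2⟩, rfl⟩
      exact ⟨lastCoord n x, hx1, _, ⟨thS n hn (pr n x), hx2, rfl⟩, rfl⟩
  rw [hae, ← lintegral_abs_det_fderiv_eq_addHaar_image volume hSm
    (fun x _ => (deriv_Ps H x).hasFDerivWithinAt) ((Ps_inj hn).mono fun x hx => hx.1.1)]
  simp only [det_Ps H]
  rw [← lintegral_indicator hSm]
  set G : ℝ → Eu (n - 1) → ℝ≥0∞ := fun t y => T.indicator (fun y => ENNReal.ofReal (la n y ^ (n - 1))) y *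
    (Set.Ioo (0 : ℝ) 1).indicator (fun t => ENNReal.ofReal (t ^ (n - 1))) t with hG
  have hGm : Measurable (Function.uncurry G) := by
    refine Measurable.mul ?_ ?_
    · exact (((mla.pow_const _).ennreal_ofReal).indicator hTm).comp measurable_snd
    · exact ((measurable_id.pow_const _).ennreal_ofReal.indicator measurableSet_Ioo).comp measurable_fst
  have e : ∀ x : Eu n, S.indicator (fun x => ENNReal.ofReal
      (|lastCoord n x * la n (pr n x)| ^ (n - 1))) x = G (lastCoord n x) (pr n x) := by
    intro x
    by_cases h1 : 0 < lastCoord n x ∧ lastCoord n x < 1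
    · by_cases h2 : pr n x ∈ T
      · have : x ∈ S := ⟨h1, h2⟩
        rw [Set.indicator_of_mem this, hG]
        simp only
        rw [Set.indicator_of_mem h2, Set.indicator_of_mem (show lastCoord n x ∈ Set.Ioo (0 : ℝ) 1 from h1),
          abs_of_pos (mul_pos h1.1 (la_pos _)), mul_pow, mul_comm,
          ENNReal.ofReal_mul (by have := la_pos (pr n x); positivity)]
      · have : x ∉ S := fun h => h2 h.2
        rw [Set.indicator_of_notMem this, hG]
        simp only
        rw [Set.indicator_of_notMem h2, zero_mul]
    · have : x ∉ S := fun h => h1 h.1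
      rw [Set.indicator_of_notMem this, hG]
      simp only
      rw [Set.indicator_of_notMem (show lastCoord n x ∉ Set.Ioo (0 : ℝ) 1 from h1), mul_zero]
  simp only [e]
  rw [lint_split hn hGm]
  have hint : ∫⁻ t, (Set.Ioo (0 : ℝ) 1).indicator (fun t => ENNReal.ofReal (t ^ (n - 1))) t =
      ENNReal.ofReal (1 / n) := by
    rw [lintegral_indicator measurableSet_Ioo, ← ofReal_integral_eq_lintegral_ofReal]
    · rw [← integral_Ioc_eq_integral_Ioo, ← intervalIntegral.integral_of_le zero_le_one, integral_pow]
      congr 1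
      have : ((n - 1 : ℕ) : ℝ) + 1 = n := by rw [Nat.cast_sub (by omega)]; simp
      rw [this]; simp
    · exact ((continuous_pow (n - 1)).integrableOn_Icc (a := (0:ℝ)) (b := 1)).mono_set Set.Ioo_subset_Icc_self
    · exact (ae_restrict_iff' measurableSet_Ioo).2 (Eventually.of_forall fun t ht => pow_nonneg ht.1.le _)
  have e2 : ∀ y, ∫⁻ t, G t y = T.indicator (fun y => ENNReal.ofReal (la n y ^ (n - 1))) y *
      ENNReal.ofReal (1 / n) := by
    intro y
    rw [← hint, ← lintegral_const_mul]
    exact (measurable_id.pow_const _).ennreal_ofReal.indicator measurableSet_Ioo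
  simp only [e2]
  rw [lintegral_mul_const _ (((mla.pow_const _).ennreal_ofReal).indicator hTm),
    lintegral_indicator hTm, mul_comm, mul_assoc]
  have : ENNReal.ofReal (1 / n) * (Module.finrank ℝ (Eu n) : ℝ≥0∞) = 1 := by
    rw [finrank_euclideanSpace_fin, ← ENNReal.ofReal_natCast, ← ENNReal.ofReal_mul (by positivity)]
    rw [one_div_mul_cancel (by positivity), ENNReal.ofReal_one]
  rw [this, mul_one]

lemma surf_eq (H : Par n α) : surf n = Measure.map (fun y => inversion (xo n) 2 (emb n y)) (mu n α) := by
  have hn := H.npos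
  unfold surf
  rw [toSphere_eq H, Measure.map_map (by fun_prop) (meas_thS hn)]
  have e1 : (fun p : sphere (0 : Eu n) 1 => zo n + (p : Eu n)) ∘ thS n hn =
      fun y => inversion (xo n) 2 (emb n y) := by
    ext1 y
    simp only [Function.comp, thS, th]
    abel
  rw [e1, mu]
  congr 2
  ext1 y
  rw [hh_p H, la, ← Real.rpow_natCast, Nat.cast_sub (by omega), Nat.cast_one]

end
end HLS

namespace HLS
open EuclideanGeometry Filter Topology

section
variable {n : ℕ} {α : ℝ}

lemma meas_sig : Measurable (fun y => inversion (xo n) 2 (emb n y)) :=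
  meas_inv measurable_const measurable_const (cont_emb n).measurable

lemma bb_eq (H : Par n α) : bb n α = n * unitBallVol n := by
  have h1 : surf n Set.univ = mu n α Set.univ := by
    rw [surf_eq H, Measure.map_apply meas_sig MeasurableSet.univ, Set.preimage_univ]
  have h2 : surf n Set.univ = n * volume (ball (0 : Eu n) 1) := by
    unfold surf
    rw [Measure.map_apply (by fun_prop) MeasurableSet.univ, Set.preimage_univ,
      Measure.toSphere_apply_univ, finrank_euclideanSpace_fin]
  have h3 : ∫ _y, (1 : ℝ) ∂(mu n α) = bb n α := by
    rw [mu_integral, bb]; simp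
  rw [← h3, integral_const, smul_eq_mul, mul_one, Measure.real, ← h1, h2, ENNReal.toReal_mul,
    unitBallVol]
  simp

lemma xo_ne_of_upper (H : Par n α) {x : Eu n} (hx : x ∈ upperHalf n) : x ≠ xo n := by
  intro h
  have h1 := upper_pos hx
  rw [h, xo_eq, last_smul, last_en H.npos] at h1
  norm_num at h1

lemma inner_formula (H : Par n α) {x : Eu n} (hx : x ∈ upperHalf n) :
    ∫ ζ, (1 - ‖inversion (xo n) 2 x - zo n‖ ^ 2) *
      ‖inversion (xo n) 2 x - ζ‖ ^ (-((n : ℝ) - α + 2)) ∂surf n =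
      2 * (‖x - xo n‖ / 2) ^ (mm n α - 2) * Op n α (hh n α) x := by
  have hn := H.npos
  have hxo := xo_ne_of_upper H hx
  rw [surf_eq H, integral_map meas_sig.aemeasurable (by
    refine Measurable.aestronglyMeasurable ?_
    fun_prop), mu_integral, Op, ← integral_const_mul]
  congr 1; ext y
  rw [ball_formula hn hxo, norm_inv_inv hxo (emb_ne_xo hn y), ← hp_split y H, hh_p1 H, ← w_eq H, KK]
  have hW : 0 < ‖x - xo n‖ := norm_pos_iff.2 (sub_ne_zero.2 hxo)
  have hw : 0 < ‖emb n y - xo n‖ := norm_pos_iff.2 (sub_ne_zero.2 (emb_ne_xo hn y))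
  have hd : 0 < ‖x - emb n y‖ := norm_pos_iff.2 (sub_ne_zero.2 (ne_of_upper hx y))
  set W := ‖x - xo n‖
  set w := ‖emb n y - xo n‖
  set d := ‖x - emb n y‖
  rw [show -((n : ℝ) - α + 2) = -mm n α from rfl]
  have e1 : (4 / w ^ 2) ^ (mm n α / 2) = (2 / w) ^ mm n α := by
    rw [show 4 / w ^ 2 = (2 / w) ^ (2 : ℝ) by rw [Real.rpow_two, div_pow]; norm_num,
      ← Real.rpow_mul (by positivity)]
    congr 1; ring
  have e2 : (2 / W * (2 / w) * d) ^ (-mm n α) =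
      ((W / 2) ^ (mm n α - 2) * (W / 2) ^ 2) * ((2 / w) ^ mm n α)⁻¹ * d ^ (-mm n α) := by
    rw [Real.mul_rpow (by positivity) hd.le, Real.mul_rpow (by positivity) (by positivity),
      Real.rpow_neg (by positivity : 0 ≤ 2 / w)]
    congr 2
    rw [← Real.rpow_two, ← Real.rpow_add (by positivity), ← inv_div W 2, Real.inv_rpow (by positivity),
      Real.rpow_neg (by positivity), inv_inv]
    congr 1; ring
  rw [e1, e2]
  have h3 : (2 / w) ^ mm n α ≠ 0 := (Real.rpow_pos_of_pos (by positivity) _).ne'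
  field_simp
  ring

lemma ball_integral (H : Par n α) :
    (∫ ξ in ball (zo n) 1,
        (∫ ζ, (1 - ‖ξ - zo n‖ ^ 2) * ‖ξ - ζ‖ ^ (-((n : ℝ) - α + 2)) ∂surf n) ^
          (2 * (n : ℝ) / ((n : ℝ) - α))) = 2 ^ qq n α * Phi n α (hh n α) := by
  have hn := H.npos
  have hq := H.q_gt
  rw [← integral_indicator measurableSet_ball, inv_integral hn (xo n) two_pos, Phi,
    ← integral_const_mul, ← integral_indicator (meas_upper n)]
  apply integral_congr_ae
  filter_upwards [ae_ne hn (xo n)] with x hx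
  by_cases hu : x ∈ upperHalf n
  · rw [Set.indicator_of_mem hu, Set.indicator_of_mem ((inversion_ball hn hx).2 hu),
      inner_formula H hu, show 2 * (n : ℝ) / ((n : ℝ) - α) = qq n α from rfl]
    have hW : 0 < ‖x - xo n‖ := norm_pos_iff.2 (sub_ne_zero.2 hx)
    have h0 := Op_nonneg (α := α) hu (fun y => (hh_pos y).le : ∀ y, 0 ≤ hh n α y)
    rw [Real.mul_rpow (by positivity) h0, Real.mul_rpow (by positivity) (by positivity),
      ← Real.rpow_mul (by positivity), H.qm, pow_rpow _ (by positivity), ← inv_div _ (2 : ℝ),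
      Real.inv_rpow (by positivity)]
    have : (‖x - xo n‖ / 2) ^ (2 * (n : ℝ)) ≠ 0 := (Real.rpow_pos_of_pos (by positivity) _).ne'
    field_simp
  · rw [Set.indicator_of_notMem hu, Set.indicator_of_notMem (fun h => hu ((inversion_ball hn hx).1 h)),
      mul_zero]

lemma Ce2_eq (H : Par n α) :
    Ce2 n α / 2 = bb n α ^ (-(1 / pp n α)) * Phi n α (hh n α) ^ (1 / qq n α) := by
  have hq := H.q_gt
  have h0 := Phi_nonneg (α := α) (hh n α) fun y => (hh_pos y).le
  rw [Ce2, ball_integral H, ← bb_eq H, show ((n : ℝ) - α) / (2 * n) = 1 / qq n α by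
    rw [qq, one_div_div], show ((n : ℝ) + α - 4) / (2 * ((n : ℝ) - 1)) = 1 / pp n α by
    rw [pp, one_div_div], Real.mul_rpow (by positivity) h0, ← Real.rpow_mul (by norm_num),
    mul_one_div_cancel (by linarith), Real.rpow_one]
  ring

/-- the operator, extended-real valued -/
def OpE (n : ℕ) (α : ℝ) (f : Eu (n - 1) → ℝ) (x : Eu n) : ℝ≥0∞ :=
  ∫⁻ y, ENNReal.ofReal (KK n α x y * f y)

lemma OpE_adm (H : Par n α) {M : ℝ} {f : Eu (n - 1) → ℝ} (hf : Adm n α M f)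
    {x : Eu n} (hx : x ∈ upperHalf n) : OpE n α f x = ENNReal.ofReal (Op n α f x) := by
  unfold OpE Op
  rw [ofReal_integral_eq_lintegral_ofReal (hf.int H hx)
    (Eventually.of_forall fun y => mul_nonneg (KK_nonneg hx y) (hf.nonneg y))]

lemma hp_int_adm (H : Par n α) {M : ℝ} {f : Eu (n - 1) → ℝ} (hM : 0 ≤ M) (hf : Adm n α M f) :
    Integrable (fun y => f y ^ pp n α) := by
  refine ((hh_p_int H).const_mul (M ^ pp n α)).mono' (hf.meas.pow_const _).aestronglyMeasurable
    (Eventually.of_forall fun y => ?_)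
  rw [Real.norm_of_nonneg (Real.rpow_nonneg (hf.nonneg y) _), ← Real.mul_rpow hM (hh_pos y).le]
  exact Real.rpow_le_rpow (hf.nonneg y) (hf.le y) (by linarith [H.p_gt])

lemma eLp_adm (H : Par n α) {M : ℝ} {f : Eu (n - 1) → ℝ} (hM : 0 ≤ M) (hf : Adm n α M f) :
    (∫⁻ x in upperHalf n, OpE n α f x ^ qq n α) ^ (1 / qq n α) ≤
      ENNReal.ofReal (Ce2 n α / 2) * eLp volume f (pp n α) := by
  have hp := H.p_gt
  have hq := H.q_gt
  have hb := bb_pos H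
  have e1 : ∫⁻ x in upperHalf n, OpE n α f x ^ qq n α = ENNReal.ofReal (Phi n α f) := by
    rw [Phi, ofReal_integral_eq_lintegral_ofReal (Op_q_int H hM hf)]
    · refine setLIntegral_congr_fun (meas_upper n) fun x hx => ?_
      rw [OpE_adm H hf hx, ENNReal.ofReal_rpow_of_nonneg (Op_nonneg hx hf.nonneg) (by linarith)]
    · exact (ae_restrict_iff' (meas_upper n)).2
        (Eventually.of_forall fun x hx => Real.rpow_nonneg (Op_nonneg hx hf.nonneg) _)
  have hI0 : 0 ≤ ∫ y, f y ^ pp n α := integral_nonneg fun y => Real.rpow_nonneg (hf.nonneg y) _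
  have e2 : eLp volume f (pp n α) = ENNReal.ofReal ((∫ y, f y ^ pp n α) ^ (1 / pp n α)) := by
    rw [eLp, ← ENNReal.ofReal_rpow_of_nonneg hI0 (by positivity),
      ofReal_integral_eq_lintegral_ofReal (hp_int_adm H hM hf)
      (Eventually.of_forall fun y => Real.rpow_nonneg (hf.nonneg y) _)]
    congr 2; ext y
    rw [ENNReal.ofReal_rpow_of_nonneg (hf.nonneg y) (by linarith)]
  have hP0 := Phi_nonneg (α := α) f hf.nonneg
  have hPh := Phi_nonneg (α := α) (hh n α) fun y => (hh_pos y).le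
  have hC : 0 ≤ Ce2 n α / 2 := by rw [Ce2_eq H]; positivity
  rw [e1, e2, ENNReal.ofReal_rpow_of_nonneg hP0 (by positivity), ← ENNReal.ofReal_mul hC]
  apply ENNReal.ofReal_le_ofReal
  have h := sharp_adm H hM hf
  have h2 := Real.rpow_le_rpow (by positivity) h (by positivity : 0 ≤ 1 / qq n α)
  have eqp : qq n α / pp n α * (1 / qq n α) = 1 / pp n α := by field_simp
  rw [Real.mul_rpow hP0 (by positivity), Real.mul_rpow hPh (by positivity),
    ← Real.rpow_mul hb.le, ← Real.rpow_mul hI0, eqp] at h2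
  rw [Ce2_eq H, Real.rpow_neg hb.le]
  have hb' : 0 < bb n α ^ (1 / pp n α) := by positivity
  rw [mul_assoc, ← div_eq_inv_mul, le_div_iff₀ hb']
  exact h2

lemma eLp_gen (H : Par n α) {f : Eu (n - 1) → ℝ} (hf0 : ∀ y, 0 ≤ f y) (hfm : Measurable f) :
    (∫⁻ x in upperHalf n, OpE n α f x ^ qq n α) ^ (1 / qq n α) ≤
      ENNReal.ofReal (Ce2 n α / 2) * eLp volume f (pp n α) := by
  have hp := H.p_gt
  have hq := H.q_gt
  set F : ℕ → Eu (n - 1) → ℝ := fun k y => min (f y) (k * hh n α y) with hF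
  have hFA : ∀ k : ℕ, Adm n α (k : ℝ) (F k) := fun k =>
    ⟨hfm.min (measurable_const.mul meas_hh), fun y => le_min (hf0 y)
      (mul_nonneg (Nat.cast_nonneg k) (hh_pos y).le), fun y => min_le_right _ _⟩
  have hmono : ∀ y, Monotone fun k => F k y := fun y a b hab =>
    min_le_min le_rfl (mul_le_mul_of_nonneg_right (Nat.cast_le.2 hab) (hh_pos y).le)
  have hFle : ∀ k y, F k y ≤ f y := fun k y => min_le_left _ _
  have hsup : ∀ x ∈ upperHalf n, ⨆ k, OpE n α (F k) x = OpE n α f x := by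
    intro x hx
    unfold OpE
    rw [← lintegral_iSup]
    · congr 1; ext y
      apply le_antisymm
      · exact iSup_le fun k => ENNReal.ofReal_le_ofReal
          (mul_le_mul_of_nonneg_left (hFle k y) (KK_nonneg hx y))
      · obtain ⟨k, hk⟩ := exists_nat_ge (f y / hh n α y)
        refine le_iSup_of_le k ?_
        rw [div_le_iff₀ (hh_pos y)] at hk
        simp only [hF, min_eq_left hk, le_refl]
    · exact fun k => ((meas_KK x).mul (hFA k).meas).ennreal_ofReal
    · exact fun a b hab y => ENNReal.ofReal_le_ofReal
        (mul_le_mul_of_nonneg_left (hmono y hab) (KK_nonneg hx y))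
  have hmo : ∀ x ∈ upperHalf n, Monotone fun k => OpE n α (F k) x := fun x hx a b hab =>
    lintegral_mono fun y => ENNReal.ofReal_le_ofReal
        (mul_le_mul_of_nonneg_left (hmono y hab) (KK_nonneg hx y))
  have hle : ∀ k, (∫⁻ x in upperHalf n, OpE n α (F k) x ^ qq n α) ≤
      (ENNReal.ofReal (Ce2 n α / 2) * eLp volume f (pp n α)) ^ qq n α := by
    intro k
    have h1 := eLp_adm H (Nat.cast_nonneg k) (hFA k)
    have h2 : eLp volume (F k) (pp n α) ≤ eLp volume f (pp n α) := by
      unfold eLp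
      gcongr with y
      exact hFle k y
    have h3 := ENNReal.rpow_le_rpow (h1.trans (mul_le_mul_right h2 _))
      (by linarith : (0:ℝ) ≤ qq n α)
    rwa [← ENNReal.rpow_mul, one_div_mul_cancel (by linarith), ENNReal.rpow_one] at h3
  have e : ∫⁻ x in upperHalf n, OpE n α f x ^ qq n α =
      ⨆ k, ∫⁻ x in upperHalf n, OpE n α (F k) x ^ qq n α := by
    rw [← lintegral_iSup']
    · refine setLIntegral_congr_fun (meas_upper n) fun x hx => ?_
      rw [← hsup x hx]
      exact (ENNReal.orderIsoRpow (qq n α) (by linarith)).map_iSup _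
    · intro k
      refine AEMeasurable.pow_const ?_ _
      exact (((meas_KK2 (n := n) (α := α)).mul ((hFA k).meas.comp measurable_snd)).ennreal_ofReal.lintegral_prod_right').aemeasurable
    · refine (ae_restrict_iff' (meas_upper n)).2 (Eventually.of_forall fun x hx a b hab => ?_)
      exact ENNReal.rpow_le_rpow (hmo x hx hab) (by linarith)
  rw [e]
  calc _ ≤ ((ENNReal.ofReal (Ce2 n α / 2) * eLp volume f (pp n α)) ^ qq n α) ^ (1 / qq n α) :=
        ENNReal.rpow_le_rpow (iSup_le hle) (by positivity)
    _ = _ := by rw [← ENNReal.rpow_mul, mul_one_div_cancel (by linarith), ENNReal.rpow_one]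

end
theorem sharp_main
    (n : ℕ) (hn : 3 ≤ n) (α : ℝ) (hα2 : 2 ≤ α) (hαn : α < (n : ℝ)) (p t : ℝ)
    (hp : p = 2 * ((n : ℝ) - 1) / ((n : ℝ) + α - 4))
    (ht : t = 2 * (n : ℝ) / ((n : ℝ) + α))
    (f : Eu (n - 1) → ℝ) (hf0 : ∀ y, 0 ≤ f y) (hfm : Measurable f)
    (hfp : eLp (volume : Measure (Eu (n - 1))) f p ≠ ⊤)
    (g : Eu n → ℝ) (hg0 : ∀ x, 0 ≤ g x) (hgm : Measurable g)
    (hgt : eLp ((volume : Measure (Eu n)).restrict (upperHalf n)) g t ≠ ⊤) :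
    (∫⁻ x in upperHalf n, ∫⁻ y,
          ENNReal.ofReal (lastCoord n x) * ENNReal.ofReal (g x) * ENNReal.ofReal (f y) *
            ENNReal.ofReal ((‖x - emb n y‖ ^ 2) ^ (-(((n : ℝ) - α + 2) / 2)))
        ∂(volume : Measure (Eu (n - 1))) ∂(volume : Measure (Eu n))) ≤
      ENNReal.ofReal (Ce2 n α / 2) * eLp (volume : Measure (Eu (n - 1))) f p *
        eLp ((volume : Measure (Eu n)).restrict (upperHalf n)) g t := by
  have H : Par n α := ⟨hn, hα2, hαn⟩
  have hq := H.q_gt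
  have hnR : (0 : ℝ) < n := by exact_mod_cast H.npos
  have hKm : ∀ x, Measurable fun y => ENNReal.ofReal (KK n α x y * f y) := fun x =>
    ((meas_KK x).mul hfm).ennreal_ofReal
  have e : ∫⁻ x in upperHalf n, ∫⁻ y,
          ENNReal.ofReal (lastCoord n x) * ENNReal.ofReal (g x) * ENNReal.ofReal (f y) *
            ENNReal.ofReal ((‖x - emb n y‖ ^ 2) ^ (-(((n : ℝ) - α + 2) / 2))) =
      ∫⁻ x in upperHalf n, ENNReal.ofReal (g x) * OpE n α f x := by
    refine setLIntegral_congr_fun (meas_upper n) fun x hx => ?_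
    rw [OpE, ← lintegral_const_mul _ (hKm x)]
    congr 1; ext y
    have h1 : (‖x - emb n y‖ ^ 2) ^ (-(((n : ℝ) - α + 2) / 2)) = ‖x - emb n y‖ ^ (-mm n α) := by
      rw [← Real.rpow_two, ← Real.rpow_mul (norm_nonneg _), mm]
      congr 1; ring
    rw [h1, KK, ENNReal.ofReal_mul (mul_nonneg (upper_pos hx).le (Real.rpow_nonneg (norm_nonneg _) _)),
      ENNReal.ofReal_mul (upper_pos hx).le]
    ring
  have hOm : Measurable (OpE n α f) :=
    ((meas_KK2 (n := n) (α := α)).mul (hfm.comp measurable_snd)).ennreal_ofReal.lintegral_prod_right'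
  have hconj : t.HolderConjugate (qq n α) := by
    rw [ht, qq, Real.holderConjugate_iff]
    constructor
    · rw [lt_div_iff₀ (by linarith)]; linarith
    · rw [inv_div, inv_div]; field_simp; ring
  have hH := ENNReal.lintegral_mul_le_Lp_mul_Lq (volume.restrict (upperHalf n)) hconj
    (f := fun x => ENNReal.ofReal (g x)) (g := OpE n α f) hgm.ennreal_ofReal.aemeasurable
    hOm.aemeasurable
  have hM := eLp_gen H hf0 hfm
  rw [e, show p = pp n α from hp]
  refine hH.trans ?_
  rw [mul_comm]
  exact mul_le_mul_left hM _

end HLS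

/-- Theorem 1.2, a sharp HLS type inequality on the upper half
space with Poisson-type kernel. -/
theorem sharp_HLS_type_upper_half_space
    (n : ℕ) (hn : 3 ≤ n) (α : ℝ) (hα2 : 2 ≤ α) (hαn : α < (n : ℝ)) (p t : ℝ)
    (hp : p = 2 * ((n : ℝ) - 1) / ((n : ℝ) + α - 4))
    (ht : t = 2 * (n : ℝ) / ((n : ℝ) + α))
    (f : Eu (n - 1) → ℝ) (hf0 : ∀ y, 0 ≤ f y) (hfm : Measurable f)
    (hfp : eLp (volume : Measure (Eu (n - 1))) f p ≠ ⊤)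
    (g : Eu n → ℝ) (hg0 : ∀ x, 0 ≤ g x) (hgm : Measurable g)
    (hgt : eLp ((volume : Measure (Eu n)).restrict (upperHalf n)) g t ≠ ⊤) :
    (∫⁻ x in upperHalf n, ∫⁻ y,
          ENNReal.ofReal (lastCoord n x) * ENNReal.ofReal (g x) * ENNReal.ofReal (f y) *
            ENNReal.ofReal ((‖x - emb n y‖ ^ 2) ^ (-(((n : ℝ) - α + 2) / 2)))
        ∂(volume : Measure (Eu (n - 1))) ∂(volume : Measure (Eu n))) ≤
      ENNReal.ofReal (Ce2 n α / 2) * eLp (volume : Measure (Eu (n - 1))) f p *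
        eLp ((volume : Measure (Eu n)).restrict (upperHalf n)) g t := by
  exact HLS.sharp_main n hn α hα2 hαn p t hp ht f hf0 hfm hfp g hg0 hgm hgt
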